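/- arXiv:2012.15539 — 5 statements merged into one kernel-verified Lean document; each statement's English description precedes it below -/
import Mathlib

section
/- Let (ω₁, ω₂) be a 2-Salem element in F_q((X^{-1})) whose minimal polynomial Λ has degree 4 with roots ω₁, ω₂, ω₃, ω₄, where deg ω₃ = 0 (i.e. |ω₃| = 1). If the constant term Λ(0) is a nonzero element of F_q, then ω₁ω₂ω₃ is a Salem element, i.e. an algebraic integer over F_q[X] of absolute value > 1 all of whose other conjugates have absolute value ≤ 1, with at least one of absolute value exactly 1. -/
open scoped Classical
set_option linter.unusedVariables false

/-- Embedding of F_q[X] into F_q((X^{-1})): the Laurent-series variable is X^{-1},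
so the polynomial variable X maps to the inverse, i.e. to `single (-1) 1`. -/
noncomputable def polyEmb (Fq : Type) [Field Fq] : Polynomial Fq →+* LaurentSeries Fq :=
  Polynomial.eval₂RingHom HahnSeries.C (HahnSeries.single (-1) 1)

/-- Absolute value |ω| = q^{γ(ω)} on F_q((X^{-1})), where γ(ω) = -order(ω). -/
noncomputable def labs (Fq : Type) [Field Fq] [Fintype Fq] (ω : LaurentSeries Fq) : ℝ :=
  if ω = 0 then 0 else (Fintype.card Fq : ℝ) ^ (-ω.order)

/-- Absolute value |λ| = q^{deg λ} on F_q[X]. -/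
noncomputable def pabs (Fq : Type) [Field Fq] [Fintype Fq] (p : Polynomial Fq) : ℝ :=
  if p = 0 then 0 else (Fintype.card Fq : ℝ) ^ p.natDegree

/-- ω is a Salem element of F_q((X^{-1})). -/
def IsSalem {Fq C : Type} [Field Fq] [Fintype Fq] [Field C]
    (φL : LaurentSeries Fq →+* C) (abv : AbsoluteValue C ℝ) (ω : C) : Prop :=
  ∃ M : Polynomial (Polynomial Fq), M.Monic ∧ Irreducible M ∧
    (M.map (φL.comp (polyEmb Fq))).eval ω = 0 ∧ ω ∈ Set.range φL ∧ 1 < abv ω ∧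
    (∀ z ∈ (M.map (φL.comp (polyEmb Fq))).roots, z ≠ ω → abv z ≤ 1) ∧
    (∃ z ∈ (M.map (φL.comp (polyEmb Fq))).roots, abv z = 1)


lemma aux_polyEmb_coeff (Fq : Type) [Field Fq] (p : Polynomial Fq) (n : ℕ) :
    (polyEmb Fq p).coeff (-(n : ℤ)) = p.coeff n := by
  induction p using Polynomial.induction_on' with
  | add p q hp hq => simp [map_add, hp, hq]
  | monomial m a =>
    have : polyEmb Fq (Polynomial.monomial m a) = HahnSeries.single (-(m : ℤ)) a := by
      simp [polyEmb, HahnSeries.C_apply, HahnSeries.single_pow, HahnSeries.single_mul_single]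
    rw [this, Polynomial.coeff_monomial, HahnSeries.coeff_single]
    simp [eq_comm]

lemma aux_polyEmb_injective (Fq : Type) [Field Fq] : Function.Injective (polyEmb Fq) := by
  intro p q h
  ext n
  rw [← aux_polyEmb_coeff, ← aux_polyEmb_coeff, h]

lemma aux_hensel (Fq : Type) [Field Fq] (τ : LaurentSeries Fq) (hτ : 0 < τ.order) :
    ∃ z : LaurentSeries Fq, z ^ 2 - z + τ = 0 := by
  have hn : ((τ.order.toNat : ℕ) : ℤ) = τ.order := Int.toNat_of_nonneg hτ.le
  have key := LaurentSeries.X_order_mul_powerSeriesPart hn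
  set t : PowerSeries Fq := PowerSeries.X ^ τ.order.toNat * τ.powerSeriesPart with ht
  have hmem : t ∈ (Ideal.span {PowerSeries.X} : Ideal (PowerSeries Fq)) := by
    rw [Ideal.mem_span_singleton]
    exact Dvd.dvd.mul_right (dvd_pow_self _ (by omega)) _
  let f : Polynomial (PowerSeries Fq) := Polynomial.X ^ 2 - Polynomial.X + Polynomial.C t
  have hf : f.Monic := by
    unfold f
    monicity!
  have hu : IsUnit (f.derivative.eval 0) := by
    have h : f.derivative.eval 0 = -1 := by simp [f]
    rw [h]
    exact (isUnit_one (M := PowerSeries Fq)).neg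
  obtain ⟨a, ha, -⟩ := HenselianRing.is_henselian
    (I := (Ideal.span {PowerSeries.X} : Ideal (PowerSeries Fq))) f hf 0
    (by simpa [f] using hmem) (hu.map _)
  refine ⟨HahnSeries.ofPowerSeries ℤ Fq a, ?_⟩
  have h2 : a ^ 2 - a + t = 0 := by simpa [f, Polynomial.IsRoot] using ha
  have := congrArg (HahnSeries.ofPowerSeries ℤ Fq) h2
  rw [map_add, map_sub, map_pow, map_zero, key] at this
  exact this

lemma aux_rev {R K : Type} [CommRing R] [IsDomain R] [Field K] [Algebra R K] (p : Polynomial R)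
    (c : R) (hc : algebraMap R K c ≠ 0) (w : K) (hw : w ≠ 0) :
    Polynomial.aeval w (p.reverse.scaleRoots c) = 0 ↔
      Polynomial.aeval (algebraMap R K c / w) p = 0 := by
  have hne : algebraMap R K c / w ≠ 0 := div_ne_zero hc hw
  letI := invertibleOfNonzero hne
  have h1 := Polynomial.eval₂_reverse_eq_zero_iff (algebraMap R K) (algebraMap R K c / w) p
  rw [invOf_eq_inv, inv_div] at h1
  have h2 := Polynomial.scaleRoots_eval₂_mul (p := p.reverse) (algebraMap R K)
    (w / algebraMap R K c) c
  rw [mul_div_cancel₀ _ hc] at h2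
  rw [Polynomial.aeval_def, Polynomial.aeval_def, ← h1, h2]
  simp [hc]

theorem stmt_3 (Fq : Type) [Field Fq] [Fintype Fq]
    (C : Type) [Field C] [IsAlgClosed C]
    (φL : LaurentSeries Fq →+* C) (abv : AbsoluteValue C ℝ)
    (hna : ∀ x y : C, abv (x + y) ≤ max (abv x) (abv y))
    (hcomp : ∀ f : LaurentSeries Fq, f ≠ 0 → abv (φL f) = (Fintype.card Fq : ℝ) ^ (-f.order))
    (Λ : Polynomial (Polynomial Fq)) (hmon : Λ.Monic) (hirr : Irreducible Λ)
    (hdeg : Λ.natDegree = 4) (ω₁ ω₂ ω₃ ω₄ : C)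
    (hroots : (Λ.map (φL.comp (polyEmb Fq))).roots = {ω₁, ω₂, ω₃, ω₄})
    (hne : ω₁ ≠ ω₂) (h1 : 1 < abv ω₁) (h2 : 1 < abv ω₂)
    (hL1 : ω₁ ∈ Set.range φL) (hL2 : ω₂ ∈ Set.range φL)
    (h3 : abv ω₃ = 1) (h4 : abv ω₄ ≤ 1)
    (h0 : ∃ c : Fq, c ≠ 0 ∧ Λ.coeff 0 = Polynomial.C c) :
    IsSalem φL abv (ω₁ * ω₂ * ω₃) := by
  obtain ⟨c, hc, hc0⟩ := h0
  letI alg : Algebra (Polynomial Fq) C := (φL.comp (polyEmb Fq)).toAlgebra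
  have halg : algebraMap (Polynomial Fq) C = φL.comp (polyEmb Fq) := rfl
  have hinj : Function.Injective (algebraMap (Polynomial Fq) C) :=
    φL.injective.comp (aux_polyEmb_injective Fq)
  haveI : FaithfulSMul (Polynomial Fq) C := (faithfulSMul_iff_algebraMap_injective _ _).2 hinj
  have hmonm := hmon.map (φL.comp (polyEmb Fq))
  set P := Λ.map (φL.comp (polyEmb Fq)) with hP
  have hspl : P.Splits := IsAlgClosed.splits P
  have hdegP : P.natDegree = 4 := by rw [hP, hmon.natDegree_map, hdeg]
  have hprod := hspl.coeff_zero_eq_prod_roots_of_monic hmonm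
  have hsum := hspl.nextCoeff_eq_neg_sum_roots_of_monic hmonm
  rw [hroots] at hprod hsum
  rw [Polynomial.nextCoeff_of_natDegree_pos (by omega), hdegP] at hsum
  rw [hdegP] at hprod
  simp only [hP, Polynomial.coeff_map, hc0] at hprod hsum
  simp only [Multiset.insert_eq_cons, Multiset.prod_cons, Multiset.sum_cons,
    Multiset.prod_singleton, Multiset.sum_singleton] at hprod hsum
  set γ : C := algebraMap (Polynomial Fq) C (Polynomial.C c) with hγ
  have hγ0 : γ ≠ 0 := by
    rw [hγ, Ne, map_eq_zero_iff _ hinj]; simpa using hc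
  have hγe : γ = φL (HahnSeries.C c) := by
    rw [hγ, halg, RingHom.comp_apply, polyEmb, Polynomial.coe_eval₂RingHom, Polynomial.eval₂_C]
  have hγabs : abv γ = 1 := by
    rw [hγe, hcomp _ (by simpa using hc)]
    rw [HahnSeries.order_C, neg_zero, zpow_zero]
  have hprod' : γ = ω₁ * ω₂ * ω₃ * ω₄ := by
    rw [hγ, halg, hprod]; ring
  have hw1 : ω₁ ≠ 0 := by rintro rfl; simp at h1; linarith
  have hw2 : ω₂ ≠ 0 := by rintro rfl; simp at h2; linarith
  have hw3 : ω₃ ≠ 0 := by rintro rfl; simp at h3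
  have hw4 : ω₄ ≠ 0 := by rintro rfl; simp at hprod'; exact hγ0 hprod'
  have hθ : ω₁ * ω₂ * ω₃ = γ / ω₄ := by rw [hprod']; field_simp
  have habs : abv ω₁ * abv ω₂ * abv ω₄ = 1 := by
    have := hγabs
    rw [hprod'] at this
    simpa [h3] using this
  have h12 : 1 < abv ω₁ * abv ω₂ := by nlinarith
  have hp4 : 0 < abv ω₄ := abv.pos hw4
  have h4' : abv ω₄ < 1 := by nlinarith
  -- rationality of ω₄
  have hsr : ∃ s, φL s = ω₃ + ω₄ := by
    obtain ⟨a, ha⟩ := hL1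
    obtain ⟨b, hb⟩ := hL2
    refine ⟨-(polyEmb Fq (Λ.coeff 3)) - a - b, ?_⟩
    have h : φL (polyEmb Fq (Λ.coeff 3)) = -(ω₁ + (ω₂ + (ω₃ + ω₄))) := hsum
    rw [map_sub, map_sub, map_neg, h, ha, hb]; ring
  have hpr : ∃ p, φL p = ω₃ * ω₄ := by
    obtain ⟨a, ha⟩ := hL1
    obtain ⟨b, hb⟩ := hL2
    refine ⟨HahnSeries.C c / (a * b), ?_⟩
    rw [map_div₀, map_mul, ha, hb, ← hγe, hprod']; field_simp
  have hr4 : ∃ x, φL x = ω₄ := by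
    obtain ⟨s, hs⟩ := hsr
    obtain ⟨p, hp⟩ := hpr
    have hsabs : 1 ≤ abv (ω₃ + ω₄) := by
      have := hna (ω₃ + ω₄) (-ω₄)
      rw [add_neg_cancel_right, h3, abv.map_neg] at this
      rcases le_max_iff.1 this with h | h
      · exact h
      · linarith
    have hs0 : ω₃ + ω₄ ≠ 0 := by
      intro h; rw [h] at hsabs; simp at hsabs; linarith
    have hτe : φL (p / s ^ 2) = ω₃ * ω₄ / (ω₃ + ω₄) ^ 2 := by
      rw [map_div₀, map_pow, hs, hp]
    have hτ0 : p / s ^ 2 ≠ 0 := by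
      intro h
      rw [h, map_zero] at hτe
      have : ω₃ * ω₄ / (ω₃ + ω₄) ^ 2 ≠ 0 := by positivity
      exact this hτe.symm
    have hord : 0 < (p / s ^ 2).order := by
      have h := hcomp _ hτ0
      have hlt : abv (φL (p / s ^ 2)) < 1 := by
        rw [hτe, map_div₀, map_mul, map_pow, h3, one_mul]
        have : (1 : ℝ) ≤ abv (ω₃ + ω₄) ^ 2 := one_le_pow₀ hsabs
        rw [div_lt_one (by linarith)]
        linarith
      by_contra hcon
      rw [h] at hlt
      have : (1 : ℝ) ≤ (Fintype.card Fq : ℝ) ^ (-(p / s ^ 2).order) :=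
        one_le_zpow₀ (by exact_mod_cast Fintype.card_pos) (by omega)
      linarith
    obtain ⟨z, hz⟩ := aux_hensel Fq _ hord
    have hz' := congrArg φL hz
    rw [map_add, map_sub, map_pow, hτe, map_zero] at hz'
    have hfac : ((ω₃ + ω₄) * φL z - ω₃) * ((ω₃ + ω₄) * φL z - ω₄) = 0 := by
      field_simp at hz'
      linear_combination hz'
    rcases mul_eq_zero.1 hfac with h | h
    · refine ⟨s - s * z, ?_⟩
      rw [map_sub, map_mul, hs]
      linear_combination -h
    · refine ⟨s * z, ?_⟩
      rw [map_mul, hs]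
      linear_combination h
  -- roots
  have hP0 : P ≠ 0 := hmonm.ne_zero
  have hroot : ∀ z : C, Polynomial.aeval z Λ = 0 ↔ z = ω₁ ∨ z = ω₂ ∨ z = ω₃ ∨ z = ω₄ := by
    intro z
    have : z ∈ P.roots ↔ Polynomial.aeval z Λ = 0 := by
      rw [Polynomial.mem_roots hP0, Polynomial.IsRoot, hP, Polynomial.eval_map,
        Polynomial.aeval_def, halg]
    rw [← this, hroots]
    simp
  have hint : ∀ z : C, Polynomial.aeval z Λ = 0 → IsIntegral (Polynomial Fq) z := fun z hz => ⟨Λ, hmon, hz⟩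
  have hi1 := hint ω₁ ((hroot _).2 (by simp))
  have hi2 := hint ω₂ ((hroot _).2 (by simp))
  have hi3 := hint ω₃ ((hroot _).2 (by simp))
  have hi4 := hint ω₄ ((hroot _).2 (by simp))
  have hθi : IsIntegral (Polynomial Fq) (ω₁ * ω₂ * ω₃) := (hi1.mul hi2).mul hi3
  set θ := ω₁ * ω₂ * ω₃ with hθd
  have hθ0 : θ ≠ 0 := by rw [hθ]; exact div_ne_zero hγ0 hw4
  have hM0 : (minpoly (Polynomial Fq) θ).map (φL.comp (polyEmb Fq)) ≠ 0 :=
    ((minpoly.monic hθi).map _).ne_zero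
  have hmem : ∀ z : C, z ∈ ((minpoly (Polynomial Fq) θ).map (φL.comp (polyEmb Fq))).roots ↔
      Polynomial.aeval z (minpoly (Polynomial Fq) θ) = 0 := by
    intro z
    rw [Polynomial.mem_roots hM0, Polynomial.IsRoot, Polynomial.eval_map,
        Polynomial.aeval_def, halg]
  refine ⟨minpoly (Polynomial Fq) θ, minpoly.monic hθi, minpoly.irreducible hθi, ?_, ?_, ?_, ?_, ?_⟩
  · rw [Polynomial.eval_map, ← halg, ← Polynomial.aeval_def, minpoly.aeval]
  · obtain ⟨x, hx⟩ := hr4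
    refine ⟨HahnSeries.C c / x, ?_⟩
    rw [map_div₀, hx, ← hγe, hθ]
  · rw [hθd, map_mul, map_mul, h3, mul_one]; exact h12
  · intro z hz hzne
    rw [hmem] at hz
    have hN : Polynomial.aeval θ (Λ.reverse.scaleRoots (Polynomial.C c)) = 0 := by
      rw [aux_rev _ _ hγ0 _ hθ0, hroot]
      right; right; right
      change γ / θ = ω₄
      rw [hθ]; field_simp
    by_cases hz0 : z = 0
    · rw [hz0, map_zero]; exact zero_le_one
    obtain ⟨Q, hQ⟩ := minpoly.isIntegrallyClosed_dvd hθi hN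
    have hNz : Polynomial.aeval z (Λ.reverse.scaleRoots (Polynomial.C c)) = 0 := by
      rw [hQ, map_mul, hz, zero_mul]
    rw [aux_rev _ _ hγ0 _ hz0, hroot] at hNz
    change γ / z = _ ∨ γ / z = _ ∨ γ / z = _ ∨ γ / z = _ at hNz
    have hzabs : abv (γ / z) * abv z = 1 := by
      rw [← map_mul, div_mul_cancel₀ _ hz0, hγabs]
    have hzp := abv.pos hz0
    rcases hNz with h | h | h | h
    · rw [h] at hzabs; nlinarith
    · rw [h] at hzabs; nlinarith
    · rw [h] at hzabs; nlinarith
    · exfalso; apply hzne; rw [hθ, ← h]; field_simp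
  · refine ⟨γ / ω₃, ?_, ?_⟩
    · rw [hmem]
      have hQ4 : Polynomial.aeval ω₄ ((minpoly (Polynomial Fq) θ).reverse.scaleRoots (Polynomial.C c)) = 0 := by
        rw [aux_rev _ _ hγ0 _ hw4]
        change Polynomial.aeval (γ / ω₄) _ = 0
        rw [← hθ, minpoly.aeval]
      have hd := minpoly.isIntegrallyClosed_dvd hi4 hQ4
      have hd2 := minpoly.isIntegrallyClosed_dvd hi4 ((hroot ω₄).2 (by simp))
      have has : Associated (minpoly (Polynomial Fq) ω₄) Λ :=
        (minpoly.irreducible hi4).associated_of_dvd hirr hd2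
      obtain ⟨Q, hQ⟩ := has.symm.dvd.trans hd
      have h3' : Polynomial.aeval ω₃ ((minpoly (Polynomial Fq) θ).reverse.scaleRoots (Polynomial.C c)) = 0 := by
        rw [hQ, map_mul, (hroot ω₃).2 (by simp), zero_mul]
      rwa [aux_rev _ _ hγ0 _ hw3] at h3'
    · rw [map_div₀, hγabs, h3, div_one]
end

section
/- Let n ≥ 3 and Λ(Y) = Yⁿ + λ_{n-1}Y^{n-1} + … + λ₁Y + λ₀ ∈ F_q[X][Y] with λ₀ ≠ 0. If deg λ_{n-1} < max_{0 ≤ k < n-2} deg λ_k = deg λ_{n-2} < 2 deg λ_{n-1}, then Λ has exactly two roots ω₁, ω₂ of absolute value > 1, both of which lie in F_q((X^{-1})) (with |ω₁| = q^{deg λ_{n-1}} and |ω₂| = q^{deg λ_{n-2} − deg λ_{n-1}}), and at least one further root of absolute value exactly 1. -/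
open scoped Classical
set_option linter.unusedVariables false

lemma aux_hensel_s6 {k : Type} [Field k] (f : Polynomial (PowerSeries k)) (a0 : PowerSeries k)
    (h0 : PowerSeries.X ∣ f.eval a0)
    (h1 : PowerSeries.constantCoeff (f.derivative.eval a0) ≠ 0) :
    ∃ a, f.eval a = 0 ∧ PowerSeries.X ∣ a - a0 := by
  obtain ⟨v, hv⟩ : ∃ v, f.derivative.eval a0 * v = 1 :=
    ⟨(f.derivative.eval a0)⁻¹, PowerSeries.mul_inv_cancel _ h1⟩
  let s : ℕ → PowerSeries k := fun m => Nat.rec a0 (fun _ a => a - v * f.eval a) m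
  have hs : ∀ m, s (m+1) = s m - v * f.eval (s m) := fun m => rfl
  have key : ∀ m, PowerSeries.X ∣ s m - a0 ∧ PowerSeries.X ^ (m+1) ∣ f.eval (s m) := by
    intro m
    induction m with
    | zero => exact ⟨by simp [s], by simpa [s] using h0⟩
    | succ m ih =>
      obtain ⟨⟨c, hc⟩, ⟨d, hd⟩⟩ := ih
      refine ⟨⟨c - v * PowerSeries.X ^ m * d, ?_⟩, ?_⟩
      · rw [hs, hd]; linear_combination hc
      · obtain ⟨w, hw⟩ := f.binomExpansion (s m) (-(v * f.eval (s m)))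
        obtain ⟨t, ht⟩ := f.derivative.evalSubFactor (s m) a0
        rw [hs, sub_eq_add_neg, hw]
        refine ⟨- t * c * v * d + w * v^2 * PowerSeries.X ^ m * d^2, ?_⟩
        have : f.derivative.eval (s m) = f.derivative.eval a0 + t * (PowerSeries.X * c) := by
          rw [← hc, ← ht]; ring
        rw [this, hd]
        linear_combination (-(PowerSeries.X ^ (m+1) * d)) * hv
  have hdiff : ∀ m j, PowerSeries.X ^ (m+1) ∣ s (m+j) - s m := by
    intro m j
    induction j with
    | zero => simp
    | succ j ih =>
      have : s (m+(j+1)) - s m = (s (m+j) - s m) - v * f.eval (s (m+j)) := by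
        rw [← add_assoc, hs]; ring
      rw [this]
      exact dvd_sub ih (((pow_dvd_pow _ (by omega)).trans (key (m+j)).2).mul_left v)
  let a : PowerSeries k := PowerSeries.mk fun m => PowerSeries.coeff m (s m)
  have ha : ∀ m, PowerSeries.X ^ (m+1) ∣ a - s m := by
    intro m
    rw [PowerSeries.X_pow_dvd_iff]
    intro d hd
    obtain ⟨j, rfl⟩ := Nat.exists_eq_add_of_le (Nat.lt_succ_iff.mp hd)
    have := (PowerSeries.X_pow_dvd_iff.mp (hdiff d j)) d (by omega)
    rw [map_sub, sub_eq_zero] at this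
    rw [map_sub, this]; simp [a]
  refine ⟨a, ?_, ?_⟩
  · ext m
    obtain ⟨t, ht⟩ := f.evalSubFactor a (s m)
    have : PowerSeries.X ^ (m+1) ∣ f.eval a := by
      have h2 : f.eval a = t * (a - s m) + f.eval (s m) := by rw [← ht]; ring
      rw [h2]
      exact dvd_add ((ha m).mul_left t) (key m).2
    simpa using PowerSeries.X_pow_dvd_iff.mp this m (by omega)
  · simpa [s] using ha 0

lemma aux_root {k : Type} [Field k] (P : Polynomial (LaurentSeries k)) (m : ℕ)
    (hneg : ∀ i, ∀ j < 0, (P.coeff i).coeff j = 0)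
    (hz : ∀ i, i ≠ m → i ≠ m + 1 → (P.coeff i).coeff 0 = 0)
    (hm : (P.coeff m).coeff 0 ≠ 0) (hm1 : (P.coeff (m+1)).coeff 0 ≠ 0) :
    ∃ z : LaurentSeries k, z ≠ 0 ∧ z.order = 0 ∧ P.eval z = 0 := by
  have hl : P ∈ Polynomial.lifts (HahnSeries.ofPowerSeries ℤ k) := by
    rw [Polynomial.lifts_iff_coeff_lifts]
    intro i
    refine ⟨PowerSeries.mk fun d => (P.coeff i).coeff d, ?_⟩
    ext j
    rw [PowerSeries.coeff_coe]
    split_ifs with h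
    · exact (hneg i j h).symm
    · rw [PowerSeries.coeff_mk]; congr 1; omega
  obtain ⟨f, rfl⟩ := (Polynomial.mem_lifts _).mp hl
  have hc : ∀ i, ((f.map (HahnSeries.ofPowerSeries ℤ k)).coeff i).coeff 0
      = (f.map PowerSeries.constantCoeff).coeff i := by
    intro i
    rw [Polynomial.coeff_map, Polynomial.coeff_map, PowerSeries.coeff_coe]
    simp
  simp only [hc] at hz hm hm1
  set g := f.map PowerSeries.constantCoeff with hg
  set a := g.coeff (m+1)
  set b := g.coeff m
  have hgeq : g = Polynomial.C a * Polynomial.X ^ (m+1) + Polynomial.C b * Polynomial.X ^ m := by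
    ext i
    simp only [Polynomial.coeff_add, Polynomial.coeff_C_mul, Polynomial.coeff_X_pow]
    by_cases h1 : i = m
    · subst h1; simp [b]
    by_cases h2 : i = m+1
    · subst h2; simp [a]
    rw [hz i h1 h2]; simp [h1, h2]
  set r := -b / a with hr
  have hab : a * r = -b := by rw [hr]; field_simp
  have hr0 : r ≠ 0 := div_ne_zero (neg_ne_zero.mpr hm) hm1
  have e1 : PowerSeries.constantCoeff (f.eval (PowerSeries.C r)) = g.eval r := by
    rw [hg, ← Polynomial.eval_map_apply]; simp
  have e2 : PowerSeries.constantCoeff (f.derivative.eval (PowerSeries.C r))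
      = g.derivative.eval r := by
    rw [hg, Polynomial.derivative_map, ← Polynomial.eval_map_apply]; simp
  obtain ⟨z, hz0, hz1⟩ := aux_hensel_s6 f (PowerSeries.C r)
    (by
      rw [PowerSeries.X_dvd_iff, e1, hgeq]
      simp only [Polynomial.eval_add, Polynomial.eval_mul, Polynomial.eval_C,
        Polynomial.eval_pow, Polynomial.eval_X]
      linear_combination r ^ m * hab)
    (by
      rw [e2, hgeq]
      have : (Polynomial.derivative (Polynomial.C a * Polynomial.X ^ (m+1)
          + Polynomial.C b * Polynomial.X ^ m)).eval r = a * r ^ m := by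
        rcases m with _ | m
        · simp
        · simp
          linear_combination (m+1) * r^m * hab
      rw [this]
      exact mul_ne_zero hm1 (pow_ne_zero _ hr0))
  rw [PowerSeries.X_dvd_iff, map_sub, sub_eq_zero] at hz1
  have hcz : (HahnSeries.ofPowerSeries ℤ k z).coeff 0 ≠ 0 := by
    rw [PowerSeries.coeff_coe]; simpa [hz1] using hr0
  have hzne : HahnSeries.ofPowerSeries ℤ k z ≠ 0 := by
    intro h; rw [h] at hcz; simp at hcz
  refine ⟨HahnSeries.ofPowerSeries ℤ k z, hzne, ?_, ?_⟩
  · refine le_antisymm (HahnSeries.order_le_of_coeff_ne_zero hcz) ?_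
    rw [HahnSeries.le_order_iff_forall hzne]
    intro j hj
    rw [PowerSeries.coeff_coe, if_pos hj]
  · rw [Polynomial.eval_map_apply, hz0, map_zero]

lemma aux_emb {k : Type} [Field k] (p : Polynomial k) (j : ℤ) :
    (polyEmb k p).coeff j = if j ≤ 0 then p.coeff (-j).toNat else 0 := by
  induction p using Polynomial.induction_on' with
  | add p q hp hq =>
    rw [map_add, HahnSeries.coeff_add, hp, hq]; split_ifs <;> simp
  | monomial d a =>
    have : polyEmb k (Polynomial.monomial d a) = HahnSeries.single (-(d:ℤ)) a := by
      simp [polyEmb, Polynomial.eval₂_monomial, HahnSeries.single_pow, HahnSeries.C_apply]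
    rw [this, HahnSeries.coeff_single, Polynomial.coeff_monomial]
    split_ifs <;> first | rfl | omega

lemma aux_order {k : Type} [Field k] (p : Polynomial k) (hp : p ≠ 0) :
    polyEmb k p ≠ 0 ∧ (polyEmb k p).order = -(p.natDegree : ℤ) := by
  have hc : (polyEmb k p).coeff (-(p.natDegree : ℤ)) ≠ 0 := by
    rw [aux_emb]; simpa using hp
  have hne : polyEmb k p ≠ 0 := by intro h; rw [h] at hc; simp at hc
  refine ⟨hne, le_antisymm (HahnSeries.order_le_of_coeff_ne_zero hc) ?_⟩
  rw [HahnSeries.le_order_iff_forall hne]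
  intro j hj
  rw [aux_emb, if_pos (by omega)]
  exact Polynomial.coeff_eq_zero_of_natDegree_lt (by omega)

lemma aux_newton {k : Type} [Field k] (Q : Polynomial (Polynomial k)) (m : ℕ) (e s : ℤ)
    (hz : ∀ i, i ≠ m → i ≠ m + 1 → Q.coeff i ≠ 0 → ((Q.coeff i).natDegree : ℤ) < s - e * i)
    (hm0 : Q.coeff m ≠ 0) (hm : ((Q.coeff m).natDegree : ℤ) = s - e * m)
    (hm0' : Q.coeff (m+1) ≠ 0) (hm' : ((Q.coeff (m+1)).natDegree : ℤ) = s - e * (m+1)) :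
    ∃ z : LaurentSeries k, z ≠ 0 ∧ z.order = -e ∧ (Q.map (polyEmb k)).eval z = 0 := by
  let P : Polynomial (LaurentSeries k) := Polynomial.C (HahnSeries.single s 1) *
    (Q.map (polyEmb k)).comp (Polynomial.C (HahnSeries.single (-e) 1) * Polynomial.X)
  have hP : ∀ i j, (P.coeff i).coeff j
      = if j - s + e * i ≤ 0 then (Q.coeff i).coeff (-(j - s + e * i)).toNat else 0 := by
    intro i j
    simp only [P, Polynomial.coeff_C_mul, Polynomial.comp_C_mul_X_coeff, Polynomial.coeff_map,
      HahnSeries.single_pow, HahnSeries.coeff_single_mul, HahnSeries.coeff_mul_single, aux_emb]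
    have : j - s - i • (-e) = j - s + e * i := by simp; ring
    rw [this, one_pow, one_mul, mul_one]
  have hle : ∀ i, Q.coeff i ≠ 0 → ((Q.coeff i).natDegree : ℤ) ≤ s - e * i := by
    intro i hi
    by_cases h1 : i = m
    · subst h1; exact hm.le
    by_cases h2 : i = m+1
    · subst h2; push_cast; exact hm'.le
    exact (hz i h1 h2 hi).le
  obtain ⟨z, hz0, hzo, hzr⟩ := aux_root P m
    (by
      intro i j hj
      rw [hP]
      split_ifs with h
      · by_cases hi : Q.coeff i = 0
        · simp [hi]
        have := hle i hi
        exact Polynomial.coeff_eq_zero_of_natDegree_lt (by omega)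
      · rfl)
    (by
      intro i h1 h2
      rw [hP]
      split_ifs with h
      · by_cases hi : Q.coeff i = 0
        · simp [hi]
        have := hz i h1 h2 hi
        exact Polynomial.coeff_eq_zero_of_natDegree_lt (by omega)
      · rfl)
    (by
      rw [hP, if_pos (by omega)]
      rw [show (-(0 - s + e * (m:ℤ))).toNat = (Q.coeff m).natDegree by omega]
      simpa using hm0)
    (by
      rw [hP, if_pos (by push_cast; omega)]
      rw [show (-(0 - s + e * ((m+1:ℕ):ℤ))).toNat = (Q.coeff (m+1)).natDegree by push_cast; omega]
      simpa using hm0')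
  have hs : ∀ t : ℤ, (HahnSeries.single t (1:k) : LaurentSeries k) ≠ 0 := fun t => by simp
  refine ⟨HahnSeries.single (-e) 1 * z, mul_ne_zero (hs _) hz0, ?_, ?_⟩
  · rw [HahnSeries.order_mul (hs _) hz0, hzo, HahnSeries.order_single one_ne_zero, add_zero]
  · simp only [P, Polynomial.eval_mul, Polynomial.eval_C, Polynomial.eval_comp,
      Polynomial.eval_X] at hzr
    exact (mul_eq_zero.mp hzr).resolve_left (hs _)

lemma aux_div {C : Type} [Field C] (abv : AbsoluteValue C ℝ)
    (hna : ∀ x y : C, abv (x + y) ≤ max (abv x) (abv y))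
    (N : Polynomial C) (w : C) (hw : 1 ≤ abv w) (B : ℝ) (hB : 0 ≤ B)
    (h : ∀ i, abv (((Polynomial.X - Polynomial.C w) * N).coeff i) ≤ B) :
    ∀ i, abv (N.coeff i) ≤ B / abv w := by
  have hpos : 0 < abv w := by linarith
  have hBw : B / abv w ≤ B := div_le_self hB hw
  intro i
  induction i with
  | zero =>
    have := h 0
    rw [le_div_iff₀ hpos]
    simpa [mul_comm] using this
  | succ i ih =>
    have h1 := h (i+1)
    rw [Polynomial.coeff_X_sub_C_mul] at h1
    rw [le_div_iff₀ hpos, mul_comm, ← map_mul]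
    have : w * N.coeff (i+1) = N.coeff i + -(N.coeff i - w * N.coeff (i+1)) := by ring
    rw [this]
    refine (hna _ _).trans (max_le (ih.trans hBw) ?_)
    rwa [AbsoluteValue.map_neg]

lemma aux_prod {C : Type} [Field C] (abv : AbsoluteValue C ℝ)
    (hna : ∀ x y : C, abv (x + y) ≤ max (abv x) (abv y)) (s : Multiset C) :
    (∀ z ∈ s, abv z < 1) → ∀ i < s.card,
      abv (((s.map fun a => Polynomial.X - Polynomial.C a).prod).coeff i) < 1 := by
  induction s using Multiset.induction_on with
  | empty => intro _ i hi; simp at hi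
  | cons a s ih =>
    intro hs i hi
    rw [Multiset.card_cons] at hi
    have ha := hs a (Multiset.mem_cons_self a s)
    have ih' := ih (fun z hz => hs z (Multiset.mem_cons_of_mem hz))
    rw [Multiset.map_cons, Multiset.prod_cons]
    set P := (s.map fun a => Polynomial.X - Polynomial.C a).prod with hPd
    have h2 : abv (-(a * P.coeff i)) < 1 := by
      rw [AbsoluteValue.map_neg, map_mul]
      have : abv (P.coeff i) ≤ 1 := by
        rcases Nat.lt_succ_iff_lt_or_eq.mp hi with h | h
        · exact (ih' i h).le
        · have hmon : P.Monic := Polynomial.monic_multiset_prod_of_monic _ _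
            (fun a _ => Polynomial.monic_X_sub_C a)
          have hd : P.natDegree = i := by
            rw [hPd, Polynomial.natDegree_multiset_prod_X_sub_C_eq_card, h]
          have := hmon.coeff_natDegree
          rw [hd] at this
          rw [this]; simp
      have := abv.nonneg a
      have := abv.nonneg (P.coeff i)
      nlinarith
    rcases i with _ | i
    · simpa using h2
    · rw [Polynomial.coeff_X_sub_C_mul, sub_eq_add_neg]
      exact (hna _ _).trans_lt (max_lt (ih' i (by omega)) h2)

theorem stmt_6 (Fq : Type) [Field Fq] [Fintype Fq]
    (C : Type) [Field C] [IsAlgClosed C]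
    (φL : LaurentSeries Fq →+* C) (abv : AbsoluteValue C ℝ)
    (hna : ∀ x y : C, abv (x + y) ≤ max (abv x) (abv y))
    (hcomp : ∀ f : LaurentSeries Fq, f ≠ 0 → abv (φL f) = (Fintype.card Fq : ℝ) ^ (-f.order))
    (n : ℕ) (hn : 3 ≤ n) (Λ : Polynomial (Polynomial Fq))
    (hmon : Λ.Monic) (hdeg : Λ.natDegree = n) (h0 : Λ.coeff 0 ≠ 0)
    (hne1 : Λ.coeff (n - 1) ≠ 0) (hne2 : Λ.coeff (n - 2) ≠ 0)
    (hlt : (Λ.coeff (n - 1)).natDegree < (Λ.coeff (n - 2)).natDegree)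
    (hmax : ∀ k < n - 2, pabs Fq (Λ.coeff k) ≤ pabs Fq (Λ.coeff (n - 2)))
    (hatt : ∃ k < n - 2, pabs Fq (Λ.coeff k) = pabs Fq (Λ.coeff (n - 2)))
    (hlt2 : (Λ.coeff (n - 2)).natDegree < 2 * (Λ.coeff (n - 1)).natDegree) :
    ∃ ω₁ ω₂ : C, ω₁ ≠ ω₂ ∧ ω₁ ∈ Set.range φL ∧ ω₂ ∈ Set.range φL ∧
      (Λ.map (φL.comp (polyEmb Fq))).eval ω₁ = 0 ∧
      (Λ.map (φL.comp (polyEmb Fq))).eval ω₂ = 0 ∧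
      abv ω₁ = (Fintype.card Fq : ℝ) ^ (((Λ.coeff (n - 1)).natDegree : ℤ)) ∧
      abv ω₂ = (Fintype.card Fq : ℝ) ^
        (((Λ.coeff (n - 2)).natDegree : ℤ) - ((Λ.coeff (n - 1)).natDegree : ℤ)) ∧
      1 < abv ω₁ ∧ 1 < abv ω₂ ∧
      (∀ z ∈ (Λ.map (φL.comp (polyEmb Fq))).roots, 1 < abv z → z = ω₁ ∨ z = ω₂) ∧
      (∃ z ∈ (Λ.map (φL.comp (polyEmb Fq))).roots, abv z = 1) := by
  set q : ℝ := (Fintype.card Fq : ℝ) with hq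
  have hq1 : 1 < q := by
    rw [hq]; exact_mod_cast Fintype.one_lt_card
  have hq0 : 0 < q := by linarith
  have hdk : ∀ i < n - 2, Λ.coeff i ≠ 0 →
      (Λ.coeff i).natDegree ≤ (Λ.coeff (n-2)).natDegree := by
    intro i hi h
    have := hmax i hi
    rw [pabs, pabs, if_neg h, if_neg hne2] at this
    exact (pow_le_pow_iff_right₀ hq1).mp this
  set d1 := (Λ.coeff (n-1)).natDegree with hd1
  set d2 := (Λ.coeff (n-2)).natDegree with hd2
  have hlead : Λ.coeff n = 1 := by rw [← hdeg]; exact hmon.coeff_natDegree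
  have habs : ∀ p : Polynomial Fq, abv (φL (polyEmb Fq p)) = pabs Fq p := by
    intro p
    by_cases hp : p = 0
    · simp [hp, pabs]
    · obtain ⟨h1, h2⟩ := aux_order p hp
      rw [hcomp _ h1, h2, pabs, if_neg hp, neg_neg, zpow_natCast]
  obtain ⟨m, rfl⟩ : ∃ m, n = m + 3 := ⟨n - 3, by omega⟩
  simp only [show m + 3 - 1 = m + 2 by omega, show m + 3 - 2 = m + 1 by omega] at *
  obtain ⟨w1, hw1, ho1, hr1⟩ := aux_newton Λ (m+2) d1 ((m+3) * d1)
    (by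
      intro i h1 h2 h3
      by_cases hi : i = m + 1
      · subst hi
        rw [← hd2]; push_cast; nlinarith
      have hi2 : i < m + 1 := by
        by_contra hcon
        exact h3 (Polynomial.coeff_eq_zero_of_natDegree_lt (by omega))
      have h4 := hdk i hi2 h3
      have h5 : (i:ℤ) + 1 ≤ m + 1 := by exact_mod_cast hi2
      have h6 : ((Λ.coeff i).natDegree : ℤ) ≤ d2 := by exact_mod_cast h4
      have h7 : (d2:ℤ) < 2 * d1 := by exact_mod_cast hlt2
      have h8 : (0:ℤ) ≤ d1 := by positivity
      nlinarith)
    hne1 (by rw [← hd1]; push_cast; ring)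
    (by rw [hlead]; exact one_ne_zero) (by rw [hlead]; simp; ring)
  obtain ⟨w2, hw2, ho2, hr2⟩ := aux_newton Λ (m+1) ((d2:ℤ) - d1) ((m+2) * ((d2:ℤ) - d1) + d1)
    (by
      intro i h1 h2 h3
      have h7 : (d2:ℤ) < 2 * d1 := by exact_mod_cast hlt2
      have h9 : (d1:ℤ) < d2 := by exact_mod_cast hlt
      by_cases hi : i = m + 3
      · subst hi
        rw [hlead]; push_cast; simp; nlinarith
      have hi2 : i < m + 1 := by
        by_contra hcon
        exact h3 (Polynomial.coeff_eq_zero_of_natDegree_lt (by omega))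
      have h4 := hdk i hi2 h3
      have h5 : (i:ℤ) + 1 ≤ m + 1 := by exact_mod_cast hi2
      have h6 : ((Λ.coeff i).natDegree : ℤ) ≤ d2 := by exact_mod_cast h4
      nlinarith)
    hne2 (by rw [← hd2]; push_cast; ring)
    hne1 (by rw [← hd1]; push_cast; ring)
  set F := Λ.map (φL.comp (polyEmb Fq)) with hF
  have hev : ∀ w, (Λ.map (polyEmb Fq)).eval w = 0 → F.eval (φL w) = 0 := by
    intro w hw
    rw [hF, ← Polynomial.map_map, Polynomial.eval_map_apply, hw, map_zero]
  have ha1 : abv (φL w1) = q ^ (d1:ℤ) := by rw [hcomp _ hw1, ho1, neg_neg]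
  have ha2 : abv (φL w2) = q ^ ((d2:ℤ) - d1) := by rw [hcomp _ hw2, ho2, neg_neg]
  have hgt1 : 1 < abv (φL w1) := by
    rw [ha1]; exact one_lt_zpow₀ hq1 (by omega)
  have hgt2 : 1 < abv (φL w2) := by
    rw [ha2]; exact one_lt_zpow₀ hq1 (by omega)
  have hlt12 : abv (φL w2) < abv (φL w1) := by
    rw [ha1, ha2]; exact zpow_lt_zpow_right₀ hq1 (by omega)
  have hprod : abv (φL w1) * abv (φL w2) = q ^ d2 := by
    rw [ha1, ha2, ← zpow_add₀ hq0.ne', ← zpow_natCast]; congr 1; ring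
  have hne : φL w1 ≠ φL w2 := by
    intro h; rw [h] at hlt12; exact lt_irrefl _ hlt12
  have hFmon : F.Monic := hmon.map _
  have hF0 : F ≠ 0 := hFmon.ne_zero
  have hFdeg : F.natDegree = m + 3 := by rw [hF, hmon.natDegree_map, hdeg]
  have hFc : ∀ i, abv (F.coeff i) = pabs Fq (Λ.coeff i) := by
    intro i; rw [hF, Polynomial.coeff_map, RingHom.comp_apply, habs]
  have hp2 : pabs Fq (Λ.coeff (m+1)) = q ^ d2 := by rw [pabs, if_neg hne2, hd2]
  have hFle : ∀ i, abv (F.coeff i) ≤ q ^ d2 := by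
    intro i
    rw [hFc]
    by_cases h3 : Λ.coeff i = 0
    · rw [pabs, if_pos h3]; positivity
    have hi : i ≤ m + 3 := by
      by_contra hcon
      exact h3 (Polynomial.coeff_eq_zero_of_natDegree_lt (by omega))
    rcases Nat.lt_or_ge i (m+1) with h | h
    · rw [← hp2]; exact hmax i h
    rw [pabs, if_neg h3]
    refine pow_le_pow_right₀ hq1.le ?_
    obtain rfl | rfl | rfl : i = m+1 ∨ i = m+2 ∨ i = m+3 := by omega
    · exact le_rfl
    · exact hlt.le
    · rw [hlead]; simp
  obtain ⟨M, hM⟩ := Polynomial.dvd_iff_isRoot.mpr (hev w1 hr1)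
  have hMr : M.eval (φL w2) = 0 := by
    have := hev w2 hr2
    rw [hM, Polynomial.eval_mul] at this
    refine (mul_eq_zero.mp this).resolve_left ?_
    simpa [sub_eq_zero] using hne.symm
  obtain ⟨N, hN⟩ := Polynomial.dvd_iff_isRoot.mpr hMr
  have hMle := aux_div abv hna M (φL w1) hgt1.le (q ^ d2) (by positivity)
    (by rw [← hM]; exact hFle)
  have hNle := aux_div abv hna N (φL w2) hgt2.le (q ^ d2 / abv (φL w1)) (by positivity)
    (by rw [← hN]; exact hMle)
  have hone : q ^ d2 / abv (φL w1) / abv (φL w2) = 1 := by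
    rw [← hprod, div_div, div_self]
    positivity
  rw [hone] at hNle
  have hMmon : M.Monic := (Polynomial.monic_X_sub_C (φL w1)).of_mul_monic_left (hM ▸ hFmon)
  have hNmon : N.Monic := (Polynomial.monic_X_sub_C (φL w2)).of_mul_monic_left (hN ▸ hMmon)
  have hNdeg : N.natDegree = m + 1 := by
    have h1 := hFdeg
    rw [hM, (Polynomial.monic_X_sub_C _).natDegree_mul hMmon, hN,
      (Polynomial.monic_X_sub_C _).natDegree_mul hNmon] at h1
    simp at h1; omega
  have hNroot : ∀ z, N.eval z = 0 → abv z ≤ 1 := by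
    intro z hz
    by_contra! hcon
    obtain ⟨K, hK⟩ := Polynomial.dvd_iff_isRoot.mpr hz
    have hKmon : K.Monic := (Polynomial.monic_X_sub_C z).of_mul_monic_left (hK ▸ hNmon)
    have h1 := aux_div abv hna K z hcon.le 1 zero_le_one (by rw [← hK]; exact hNle) K.natDegree
    rw [hKmon.coeff_natDegree, map_one, le_div_iff₀ (by linarith)] at h1
    linarith
  refine ⟨φL w1, φL w2, hne, ⟨w1, rfl⟩, ⟨w2, rfl⟩, hev w1 hr1, hev w2 hr2, ha1, ha2,
    hgt1, hgt2, ?_, ?_⟩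
  · intro z hz hz1
    have h1 := (Polynomial.mem_roots'.mp hz).2
    rw [Polynomial.IsRoot, hM, hN] at h1
    simp only [Polynomial.eval_mul, mul_eq_zero, Polynomial.eval_sub, Polynomial.eval_X,
      Polynomial.eval_C, sub_eq_zero] at h1
    rcases h1 with h | h | h
    · exact Or.inl h
    · exact Or.inr h
    · exact absurd (hNroot z h) (not_le.mpr hz1)
  · by_contra! hcon
    have hlt1 : ∀ z ∈ N.roots, abv z < 1 := by
      intro z hz
      have h1 := (Polynomial.mem_roots'.mp hz).2
      refine lt_of_le_of_ne (hNroot z h1) (hcon z ?_)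
      rw [Polynomial.mem_roots hF0, Polynomial.IsRoot, hM, hN, Polynomial.eval_mul,
        Polynomial.eval_mul, h1, mul_zero, mul_zero]
    have hspl := IsAlgClosed.splits N
    have hNlow : ∀ i < m + 1, abv (N.coeff i) < 1 := by
      intro i hi
      have h1 := aux_prod abv hna N.roots hlt1 i
        (by rw [← hspl.natDegree_eq_card_roots, hNdeg]; exact hi)
      rwa [← hspl.eq_prod_roots_of_monic hNmon] at h1
    have hmul : ∀ i ≤ m, abv (M.coeff i) < abv (φL w2) := by
      intro i hi
      have hb : abv (-(φL w2 * N.coeff i)) < abv (φL w2) := by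
        rw [AbsoluteValue.map_neg, map_mul]
        have := hNlow i (by omega)
        nlinarith
      rw [hN]
      rcases i with _ | i
      · simpa using hb
      · rw [Polynomial.coeff_X_sub_C_mul, sub_eq_add_neg]
        exact (hna _ _).trans_lt (max_lt ((hNle i).trans_lt hgt2) hb)
    obtain ⟨i, hi, hieq⟩ := hatt
    have hb : abv (-(φL w1 * M.coeff i)) < q ^ d2 := by
      rw [AbsoluteValue.map_neg, map_mul, ← hprod]
      have := hmul i (by omega)
      nlinarith
    have hfin : abv (F.coeff i) < q ^ d2 := by
      rw [hM]
      rcases i with _ | i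
      · simpa using hb
      · rw [Polynomial.coeff_X_sub_C_mul, sub_eq_add_neg]
        refine (hna _ _).trans_lt (max_lt ((hmul i (by omega)).trans ?_) hb)
        rw [← hprod]
        nlinarith
    rw [hFc, hieq, hp2] at hfin
    exact lt_irrefl _ hfin
end

section
/- Let q not be a power of 2 and Λ(Y) = Y³ + λ₂Y² + λ₁Y + λ₀ ∈ F_q[X][Y] with 2·deg λ₂ < deg λ₁ = deg λ₀. Let ω₁ be a root of Λ with |ω₁| > 1. Then ω₁ ∈ F_q((X^{-1})) if and only if the polynomial part [ω₁] lies in F_q[X] and deg λ₁ is even and nonzero. -/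
open scoped Classical
set_option linter.unusedVariables false

namespace Stmt10Aux

lemma two_ne (Fq : Type) [Field Fq] [Fintype Fq]
    (hq : ∀ r : ℕ, 1 ≤ r → Fintype.card Fq ≠ 2 ^ r) : (2 : Fq) ≠ 0 := by
  intro h
  have : CharP Fq 2 := CharTwo.of_one_ne_zero_of_two_eq_zero one_ne_zero h
  obtain ⟨n, -, hn⟩ := FiniteField.card Fq 2
  exact hq n n.pos hn

lemma polyEmb_monomial (Fq : Type) [Field Fq] (k : ℕ) (a : Fq) :
    polyEmb Fq (Polynomial.monomial k a) = HahnSeries.single (-(k : ℤ)) a := by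
  simp [polyEmb, HahnSeries.single_pow, HahnSeries.C_apply, HahnSeries.single_mul_single]

lemma polyEmb_coeff (Fq : Type) [Field Fq] (P : Polynomial Fq) (n : ℤ) :
    (polyEmb Fq P).coeff n = if n ≤ 0 then P.coeff (-n).toNat else 0 := by
  induction P using Polynomial.induction_on' with
  | add p q hp hq =>
    rw [map_add, HahnSeries.coeff_add, hp, hq]
    split_ifs <;> simp
  | monomial k a =>
    rw [polyEmb_monomial, HahnSeries.coeff_single, Polynomial.coeff_monomial]
    split_ifs <;> first | rfl | omega

lemma polyEmb_ne (Fq : Type) [Field Fq] (P : Polynomial Fq) (hP : P ≠ 0) :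
    polyEmb Fq P ≠ 0 := by
  intro h
  apply hP
  ext k
  have := polyEmb_coeff Fq P (-(k : ℤ))
  simpa [h] using this.symm

lemma polyEmb_order (Fq : Type) [Field Fq] (P : Polynomial Fq) (hP : P ≠ 0) :
    (polyEmb Fq P).order = -(P.natDegree : ℤ) := by
  apply le_antisymm
  · apply HahnSeries.order_le_of_coeff_ne_zero
    rw [polyEmb_coeff]
    simpa using hP
  · rw [HahnSeries.le_order_iff_forall (polyEmb_ne Fq P hP)]
    intro j hj
    rw [polyEmb_coeff]
    split_ifs
    · apply Polynomial.coeff_eq_zero_of_natDegree_lt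
      omega
    · rfl

section
variable {Fq : Type} [Field Fq] [Fintype Fq] {C : Type} [Field C]
    {φL : LaurentSeries Fq →+* C} {abv : AbsoluteValue C ℝ}

lemma card_gt : (1 : ℝ) < (Fintype.card Fq : ℝ) := by
  exact_mod_cast Fintype.one_lt_card

lemma abv_poly (hcomp : ∀ f : LaurentSeries Fq, f ≠ 0 → abv (φL f) = (Fintype.card Fq : ℝ) ^ (-f.order))
    (P : Polynomial Fq) (hP : P ≠ 0) :
    abv (φL (polyEmb Fq P)) = (Fintype.card Fq : ℝ) ^ P.natDegree := by
  rw [hcomp _ (polyEmb_ne Fq P hP), polyEmb_order Fq P hP]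
  simp

lemma abv_lt_one (hcomp : ∀ f : LaurentSeries Fq, f ≠ 0 → abv (φL f) = (Fintype.card Fq : ℝ) ^ (-f.order))
    (h : LaurentSeries Fq) (hh : ∀ n : ℤ, n ≤ 0 → h.coeff n = 0) : abv (φL h) < 1 := by
  by_cases h0 : h = 0
  · simp [h0]
  rw [hcomp h h0]
  apply zpow_lt_one_of_neg₀ card_gt
  have : ¬ h.order ≤ 0 := fun hle => h0 (HahnSeries.coeff_order_eq_zero.1 (hh _ hle))
  omega

lemma coeff_of_lt_one (hcomp : ∀ f : LaurentSeries Fq, f ≠ 0 → abv (φL f) = (Fintype.card Fq : ℝ) ^ (-f.order))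
    (h : LaurentSeries Fq) (hh : abv (φL h) < 1) : h.coeff 0 = 0 := by
  by_contra h0
  have hne : h ≠ 0 := by rintro rfl; simp at h0
  have := HahnSeries.order_le_of_coeff_ne_zero h0
  rw [hcomp h hne] at hh
  have h1 : (1 : ℝ) ≤ (Fintype.card Fq : ℝ) ^ (-h.order) :=
    one_le_zpow₀ card_gt.le (by omega)
  linarith

lemma exists_ps (hcomp : ∀ f : LaurentSeries Fq, f ≠ 0 → abv (φL f) = (Fintype.card Fq : ℝ) ^ (-f.order))
    (h : LaurentSeries Fq) (hh : abv (φL h) ≤ 1) :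
    ∃ g : PowerSeries Fq, HahnSeries.ofPowerSeries ℤ Fq g = h := by
  refine ⟨PowerSeries.mk fun n => h.coeff n, ?_⟩
  by_cases hne : h = 0
  · subst hne
    have : (PowerSeries.mk fun n : ℕ => (0 : LaurentSeries Fq).coeff n) = 0 := by
      ext; simp
    rw [this, map_zero]
  have ho : 0 ≤ h.order := by
    by_contra hlt
    rw [hcomp h hne] at hh
    have := one_lt_zpow₀ (card_gt (Fq := Fq)) (n := -h.order) (by omega)
    linarith
  ext n
  rw [PowerSeries.coeff_coe]
  split_ifs with hn
  · rw [HahnSeries.coeff_eq_zero_of_lt_order (by omega)]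
  · simp only [PowerSeries.coeff_mk]
    congr 1
    omega

lemma ps_lt_one (hcomp : ∀ f : LaurentSeries Fq, f ≠ 0 → abv (φL f) = (Fintype.card Fq : ℝ) ^ (-f.order))
    (g : PowerSeries Fq) (hg : PowerSeries.constantCoeff g = 0) :
    abv (φL (HahnSeries.ofPowerSeries ℤ Fq g)) < 1 := by
  apply abv_lt_one hcomp
  intro n hn
  rw [PowerSeries.coeff_coe]
  split_ifs with h
  · rfl
  · have : n = 0 := by omega
    subst this
    simpa using hg

lemma ps_const (hcomp : ∀ f : LaurentSeries Fq, f ≠ 0 → abv (φL f) = (Fintype.card Fq : ℝ) ^ (-f.order))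
    (g : PowerSeries Fq) (hg : abv (φL (HahnSeries.ofPowerSeries ℤ Fq g)) < 1) :
    PowerSeries.constantCoeff g = 0 := by
  have := coeff_of_lt_one hcomp _ hg
  rw [PowerSeries.coeff_coe] at this
  simpa using this

lemma exists_poly (hcomp : ∀ f : LaurentSeries Fq, f ≠ 0 → abv (φL f) = (Fintype.card Fq : ℝ) ^ (-f.order))
    (f : LaurentSeries Fq) : ∃ P : Polynomial Fq, abv (φL f - φL (polyEmb Fq P)) < 1 := by
  refine ⟨∑ k ∈ Finset.range ((-f.order).toNat + 1), Polynomial.monomial k (f.coeff (-(k : ℤ))), ?_⟩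
  rw [← map_sub]
  apply abv_lt_one hcomp
  intro n hn
  rw [HahnSeries.coeff_sub, polyEmb_coeff, if_pos hn, Polynomial.finsetSum_coeff]
  simp only [Polynomial.coeff_monomial]
  rw [Finset.sum_ite_eq']
  split_ifs with h
  · rw [show -(((-n).toNat : ℕ) : ℤ) = n by omega, sub_self]
  · rw [HahnSeries.coeff_eq_zero_of_lt_order, sub_zero]
    simp only [Finset.mem_range] at h
    omega

lemma core_size (hna : ∀ x y : C, abv (x + y) ≤ max (abv x) (abv y))
    (a2 a1 a0 ω : C) (D : ℝ) (h1 : abv a1 = D) (h0 : abv a0 = D) (h2 : abv a2 ^ 2 < D)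
    (hω : ω ^ 3 + a2 * ω ^ 2 + a1 * ω + a0 = 0) (habs : 1 < abv ω) : abv ω ^ 2 = D := by
  set W := abv ω with hW
  have ha2 := abv.nonneg a2
  have hD : 0 < D := lt_of_le_of_lt (sq_nonneg _) h2
  have e3 : abv (ω ^ 3) = W ^ 3 := by simp [hW]
  have e2 : abv (a2 * ω ^ 2) = abv a2 * W ^ 2 := by simp [hW]
  have e1 : abv (a1 * ω) = D * W := by simp [hW, h1]
  rcases lt_trichotomy (W ^ 2) D with h | h | h
  · exfalso
    have hx : a1 * ω = -((ω ^ 3 + a2 * ω ^ 2) + a0) := by linear_combination hω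
    have hlt : abv (a1 * ω) < D * W := by
      rw [hx, abv.map_neg]
      refine lt_of_le_of_lt (hna _ _) (max_lt (lt_of_le_of_lt (hna _ _) (max_lt ?_ ?_)) ?_)
      · rw [e3]; nlinarith
      · rw [e2]
        have : abv a2 * W < D := by nlinarith [sq_nonneg (abv a2 - W)]
        nlinarith
      · rw [h0]; nlinarith
    linarith
  · exact h
  · exfalso
    have hx : ω ^ 3 = -((a2 * ω ^ 2 + a1 * ω) + a0) := by linear_combination hω
    have hlt : abv (ω ^ 3) < W ^ 3 := by
      rw [hx, abv.map_neg]
      refine lt_of_le_of_lt (hna _ _) (max_lt (lt_of_le_of_lt (hna _ _) (max_lt ?_ ?_)) ?_)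
      · rw [e2]
        have : abv a2 < W := by nlinarith
        nlinarith [sq_nonneg W, mul_pos (show 0 < W - abv a2 by linarith) (show 0 < W ^ 2 by positivity)]
      · rw [e1]; nlinarith
      · rw [h0]; nlinarith
    linarith

lemma core_hensel (hna : ∀ x y : C, abv (x + y) ≤ max (abv x) (abv y))
    (hcomp : ∀ f : LaurentSeries Fq, f ≠ 0 → abv (φL f) = (Fintype.card Fq : ℝ) ^ (-f.order))
    (h2 : (2 : Fq) ≠ 0) (b c e : LaurentSeries Fq) (hb : abv (φL b) < 1) (hc : abv (φL c) ≤ 1)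
    (he : abv (φL e) < 1) (w : C) (hw : w ^ 3 + φL b * w ^ 2 + φL c * w + φL e = 0)
    (hw1 : abv (w - 1) < 1) : w ∈ Set.range φL := by
  have madd : ∀ {x y : C}, abv x < 1 → abv y < 1 → abv (x + y) < 1 := fun hx hy =>
    lt_of_le_of_lt (hna _ _) (max_lt hx hy)
  have oadd : ∀ {x y : C}, abv x ≤ 1 → abv y ≤ 1 → abv (x + y) ≤ 1 := fun hx hy =>
    (hna _ _).trans (max_le hx hy)
  have mmul : ∀ {x y : C}, abv x < 1 → abv y ≤ 1 → abv (x * y) < 1 := by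
    intro x y hx hy
    rw [abv.map_mul]
    exact mul_lt_one_of_nonneg_of_lt_one_left (abv.nonneg _) hx hy
  have omul : ∀ {x y : C}, abv x ≤ 1 → abv y ≤ 1 → abv (x * y) ≤ 1 := by
    intro x y hx hy
    rw [abv.map_mul]
    exact mul_le_one₀ hx (abv.nonneg _) hy
  have mneg : ∀ {x : C}, abv x < 1 → abv (-x) < 1 := by
    intro x hx; rwa [abv.map_neg]
  have o1 : abv (1 : C) ≤ 1 := by simp
  have o2 : abv (2 : C) ≤ 1 := by
    rw [← one_add_one_eq_two]; exact oadd o1 o1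
  have o3 : abv (3 : C) ≤ 1 := by
    rw [← two_add_one_eq_three]; exact oadd o2 o1
  have hs2 : ¬ abv (2 : C) < 1 := by
    intro h
    have := coeff_of_lt_one hcomp (HahnSeries.C 2) (by rwa [map_ofNat, map_ofNat])
    simp at this
    exact h2 this
  obtain ⟨B, rfl⟩ := exists_ps hcomp b hb.le
  obtain ⟨Cc, rfl⟩ := exists_ps hcomp c hc
  obtain ⟨E, rfl⟩ := exists_ps hcomp e he.le
  let ψ : PowerSeries Fq →+* C := φL.comp (HahnSeries.ofPowerSeries ℤ Fq)
  change abv (ψ B) < 1 at hb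
  change abv (ψ Cc) ≤ 1 at hc
  change abv (ψ E) < 1 at he
  change w ^ 3 + ψ B * w ^ 2 + ψ Cc * w + ψ E = 0 at hw
  obtain ⟨s, rfl⟩ : ∃ s, w = 1 + s := ⟨w - 1, by ring⟩
  rw [add_sub_cancel_left] at hw1
  have hr : abv (1 + ψ B + ψ Cc + ψ E) < 1 := by
    have : 1 + ψ B + ψ Cc + ψ E = -(s * ((3 + s * (3 + s)) + ψ B * (2 + s) + ψ Cc)) := by
      linear_combination hw
    rw [this]
    exact mneg (mmul hw1 (oadd (oadd (oadd o3 (omul hw1.le (oadd o3 hw1.le)))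
      (omul hb.le (oadd o2 hw1.le))) hc))
  have cB : PowerSeries.constantCoeff B = 0 := ps_const hcomp B hb
  have cE : PowerSeries.constantCoeff E = 0 := ps_const hcomp E he
  have cR : PowerSeries.constantCoeff (1 + B + Cc + E) = 0 :=
    ps_const hcomp _ (by
      change abv (ψ _) < 1
      simpa using hr)
  have cC : PowerSeries.constantCoeff Cc = -1 := by
    simp [cB, cE] at cR
    linear_combination cR
  let f : Polynomial (PowerSeries Fq) :=
    Polynomial.X ^ 3 + Polynomial.C B * Polynomial.X ^ 2 + Polynomial.C Cc * Polynomial.X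
      + Polynomial.C E
  have hf : f.Monic := by
    simp only [f]
    monicity!
  have hunit : IsUnit (f.derivative.eval 1) := by
    rw [PowerSeries.isUnit_iff_constantCoeff]
    have : PowerSeries.constantCoeff (f.derivative.eval 1) = 2 := by
      have e2 : PowerSeries.constantCoeff (2 : PowerSeries Fq) = 2 := map_ofNat _ 2
      have e3 : PowerSeries.constantCoeff (3 : PowerSeries Fq) = 3 := map_ofNat _ 3
      simp [f, cB, cC, e2, e3]
      try norm_num
    rw [this]
    exact h2.isUnit
  obtain ⟨y, hy, hy1⟩ := HenselianRing.is_henselian (I := Ideal.span {(PowerSeries.X : PowerSeries Fq)})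
    f hf 1 (by
      rw [Ideal.mem_span_singleton, PowerSeries.X_dvd_iff]
      simpa [f] using cR) (hunit.map _)
  rw [Ideal.mem_span_singleton, PowerSeries.X_dvd_iff] at hy1
  have hy' : y ^ 3 + B * y ^ 2 + Cc * y + E = 0 := by
    simpa [f, Polynomial.IsRoot] using hy
  have ht : abv (ψ y - 1) < 1 := by
    have := ps_lt_one hcomp _ hy1
    change abv (ψ (y - 1)) < 1 at this
    simpa using this
  have hy2 := congrArg ψ hy'
  simp only [map_add, map_mul, map_pow, map_zero] at hy2
  refine ⟨HahnSeries.ofPowerSeries ℤ Fq y, ?_⟩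
  change ψ y = _
  obtain ⟨t, hty⟩ : ∃ t, ψ y = 1 + t := ⟨ψ y - 1, by ring⟩
  rw [hty] at hy2 ht ⊢
  rw [add_sub_cancel_left] at ht
  set F := s * (3 + s + t) + t * (3 + t) + ψ B * (1 + s + t) + (1 + ψ B + ψ Cc + ψ E) + -ψ E with hF
  have hFs : abv F < 1 := by
    refine madd (madd (madd (madd (mmul hw1 ?_) (mmul ht ?_)) (mmul hb ?_)) hr) (mneg he)
    · exact oadd (oadd o3 hw1.le) ht.le
    · exact oadd o3 ht.le
    · exact oadd (oadd o1 hw1.le) ht.le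
  have hprod : (s - t) * (2 + F) = 0 := by
    rw [hF]; linear_combination hw - hy2
  rcases mul_eq_zero.1 hprod with h | h
  · rw [sub_eq_zero.1 h]
  · exfalso
    apply hs2
    rw [show (2 : C) = -F by linear_combination h]
    exact mneg hFs

end

end Stmt10Aux

open Stmt10Aux in
theorem stmt_10 (Fq : Type) [Field Fq] [Fintype Fq]
    (C : Type) [Field C] [IsAlgClosed C]
    (φL : LaurentSeries Fq →+* C) (abv : AbsoluteValue C ℝ)
    (hna : ∀ x y : C, abv (x + y) ≤ max (abv x) (abv y))
    (hcomp : ∀ f : LaurentSeries Fq, f ≠ 0 → abv (φL f) = (Fintype.card Fq : ℝ) ^ (-f.order))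
    (hq : ∀ r : ℕ, 1 ≤ r → Fintype.card Fq ≠ 2 ^ r)
    (Λ : Polynomial (Polynomial Fq)) (hmon : Λ.Monic) (hdeg : Λ.natDegree = 3)
    (hne1 : Λ.coeff 1 ≠ 0) (hne0 : Λ.coeff 0 ≠ 0)
    (hlt : 2 * (Λ.coeff 2).natDegree < (Λ.coeff 1).natDegree)
    (heq : (Λ.coeff 1).natDegree = (Λ.coeff 0).natDegree)
    (ω₁ : C) (hω : (Λ.map (φL.comp (polyEmb Fq))).eval ω₁ = 0) (habs : 1 < abv ω₁) :
    ω₁ ∈ Set.range φL ↔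
      ((∃ P : Polynomial Fq, abv (ω₁ - φL (polyEmb Fq P)) < 1) ∧
       Even (Λ.coeff 1).natDegree ∧ (Λ.coeff 1).natDegree ≠ 0) := by
  have h2 := two_ne Fq hq
  have hroot : ω₁ ^ 3 + φL (polyEmb Fq (Λ.coeff 2)) * ω₁ ^ 2 + φL (polyEmb Fq (Λ.coeff 1)) * ω₁
      + φL (polyEmb Fq (Λ.coeff 0)) = 0 := by
    rw [Polynomial.eval_map, Polynomial.eval₂_eq_sum_range, hdeg] at hω
    have h3 : Λ.coeff 3 = 1 := by rw [← hdeg]; exact hmon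
    simp [Finset.sum_range_succ, h3] at hω
    linear_combination hω
  have hcard := card_gt (Fq := Fq)
  have h1 := abv_poly hcomp _ hne1
  have h0 := abv_poly hcomp _ hne0
  rw [← heq] at h0
  have ha2 : abv (φL (polyEmb Fq (Λ.coeff 2))) ^ 2 < (Fintype.card Fq : ℝ) ^ (Λ.coeff 1).natDegree := by
    by_cases h : Λ.coeff 2 = 0
    · rw [h]; simp; positivity
    · rw [abv_poly hcomp _ h, ← pow_mul]
      exact pow_lt_pow_right₀ hcard (by omega)
  have hsize := core_size hna _ _ _ ω₁ _ h1 h0 ha2 hroot habs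
  constructor
  · rintro ⟨f, rfl⟩
    refine ⟨exists_poly hcomp f, ?_, by omega⟩
    have hf : f ≠ 0 := by rintro rfl; simp at habs; linarith
    rw [hcomp f hf, ← zpow_natCast, ← zpow_mul, ← zpow_natCast] at hsize
    have := zpow_right_injective₀ (by linarith) hcard.ne' hsize
    rw [Nat.even_iff]
    push_cast at this
    omega
  · rintro ⟨⟨P, hP⟩, -, -⟩
    set p := φL (polyEmb Fq P) with hp
    have hpa : abv p = abv ω₁ := by
      apply le_antisymm
      · have := hna ω₁ (-(ω₁ - p))
        rw [abv.map_neg] at this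
        rw [show ω₁ + -(ω₁ - p) = p by ring] at this
        exact this.trans (max_le le_rfl (by linarith))
      · have := hna p (ω₁ - p)
        rw [show p + (ω₁ - p) = ω₁ by ring] at this
        rcases le_max_iff.1 this with h | h
        · exact h
        · linarith
    have hp0 : p ≠ 0 := by
      intro h; rw [h, abv.map_zero] at hpa; linarith
    have hppos : 0 < abv p := abv.pos hp0
    have hp1 : 1 < abv p := by rw [hpa]; exact habs
    rw [← hpa] at hsize
    obtain ⟨g, hg⟩ := core_hensel hna hcomp h2
      (polyEmb Fq (Λ.coeff 2) / polyEmb Fq P) (polyEmb Fq (Λ.coeff 1) / polyEmb Fq P ^ 2)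
      (polyEmb Fq (Λ.coeff 0) / polyEmb Fq P ^ 3)
      (by
        rw [map_div₀, map_div₀, ← hp, div_lt_one hppos]
        rw [← hsize] at ha2
        exact lt_of_pow_lt_pow_left₀ 2 hppos.le ha2)
      (by
        rw [map_div₀, map_div₀, map_pow, map_pow, ← hp, h1, hsize, div_self]
        positivity)
      (by
        rw [map_div₀, map_div₀, map_pow, map_pow, ← hp, h0, div_lt_one (by positivity), ← hsize]
        exact pow_lt_pow_right₀ hp1 (by norm_num))
      (ω₁ / p)
      (by
        rw [map_div₀, map_div₀, map_div₀, map_pow, map_pow, ← hp]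
        field_simp
        linear_combination hroot)
      (by
        rw [div_sub_one hp0, map_div₀, div_lt_one hppos]
        linarith)
    refine ⟨g * polyEmb Fq P, ?_⟩
    rw [map_mul, hg, ← hp]
    field_simp
end

section
/- (Main theorem, case n = 3) Let q not be a power of 2 and Λ(Y) = Y³ + λ₂Y² + λ₁Y + λ₀ ∈ F_q[X][Y] irreducible with λ₀ ≠ 0, satisfying deg λ₂ < deg λ₁ = max_{i ≠ 1} deg λ_i and deg λ₁ > 2·deg λ₂. Let ω₁, ω₂ be the two roots of Λ of absolute value > 1. Then (ω₁, ω₂) is a 2-Salem element lying in F_q((X^{-1})) if and only if deg λ₁ is even and the leading coefficient α_{2s} of λ₁ equals −a² for some a ∈ F_q*. -/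
open scoped Classical
set_option linter.unusedVariables false

theorem aux_polyEmb (Fq : Type) [Field Fq] (N : ℕ) (p : Polynomial Fq) (h : p.natDegree ≤ N) :
    polyEmb Fq p = HahnSeries.single (-(N:ℤ)) 1 *
      HahnSeries.ofPowerSeries ℤ Fq ((Polynomial.reflect N p : Polynomial Fq) : PowerSeries Fq) := by
  refine Polynomial.induction_with_natDegree_le (fun p => polyEmb Fq p = HahnSeries.single (-(N:ℤ)) 1 *
      HahnSeries.ofPowerSeries ℤ Fq ((Polynomial.reflect N p : Polynomial Fq) : PowerSeries Fq))
      N ?_ ?_ ?_ p h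
  · simp
  · intro n r hr hn
    rw [Polynomial.reflect_C_mul_X_pow, Polynomial.revAt_le hn]
    simp only [polyEmb, Polynomial.coe_eval₂RingHom, Polynomial.eval₂_mul, Polynomial.eval₂_C,
      Polynomial.eval₂_pow, Polynomial.eval₂_X, Polynomial.coe_mul, Polynomial.coe_C,
      Polynomial.coe_pow, Polynomial.coe_X, map_mul, map_pow, HahnSeries.ofPowerSeries_C,
      HahnSeries.ofPowerSeries_X, HahnSeries.single_pow, one_pow]
    rw [mul_left_comm, HahnSeries.single_mul_single]
    congr 2
    · have e : -(n:ℤ) = -(N:ℤ) + ((N:ℤ) - (n:ℤ)) := by ring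
      simp [Nat.cast_sub hn, ← e]
    · simp
  · intro f g _ _ hf hg
    simp only [map_add, Polynomial.reflect_add, Polynomial.coe_add, mul_add] at *
    rw [hf, hg]

theorem aux_order_s13 (Fq : Type) [Field Fq] (u : PowerSeries Fq)
    (h : PowerSeries.constantCoeff u ≠ 0) :
    HahnSeries.ofPowerSeries ℤ Fq u ≠ 0 ∧ (HahnSeries.ofPowerSeries ℤ Fq u).order = 0 := by
  have hc : (HahnSeries.ofPowerSeries ℤ Fq u).coeff 0 ≠ 0 := by
    have := LaurentSeries.coeff_coe_powerSeries u 0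
    simp only [Nat.cast_zero] at this
    rw [this]; simpa using h
  have hne : HahnSeries.ofPowerSeries ℤ Fq u ≠ 0 := by
    intro h0; rw [h0] at hc; simp at hc
  refine ⟨hne, le_antisymm (HahnSeries.order_le_of_coeff_ne_zero hc) ?_⟩
  by_contra hlt
  push Not at hlt
  have h3 := HahnSeries.coeff_order_eq_zero.not.mpr hne
  apply h3
  have := PowerSeries.coeff_coe (R := Fq) u (HahnSeries.ofPowerSeries ℤ Fq u).order
  rw [this, if_pos hlt]

theorem aux_polyOrder (Fq : Type) [Field Fq] (p : Polynomial Fq) (h : p ≠ 0) :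
    polyEmb Fq p ≠ 0 ∧ (polyEmb Fq p).order = -(p.natDegree : ℤ) ∧
      (polyEmb Fq p).coeff (-(p.natDegree : ℤ)) = p.leadingCoeff := by
  have hA := aux_polyEmb Fq p.natDegree p le_rfl
  have hcc : PowerSeries.constantCoeff
      ((Polynomial.reflect p.natDegree p : Polynomial Fq) : PowerSeries Fq) = p.leadingCoeff := by
    simp [Polynomial.coeff_reflect]
  obtain ⟨h1, h2⟩ := aux_order_s13 Fq _ (by rw [hcc]; simpa using h)
  have hs : (HahnSeries.single (-(p.natDegree:ℤ)) (1:Fq)) ≠ 0 := by simp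
  refine ⟨by rw [hA]; exact mul_ne_zero hs h1, ?_, ?_⟩
  · rw [hA, HahnSeries.order_mul hs h1, h2, HahnSeries.order_single one_ne_zero]; simp
  · rw [hA, HahnSeries.coeff_single_mul]
    have := LaurentSeries.coeff_coe_powerSeries
      ((Polynomial.reflect p.natDegree p : Polynomial Fq) : PowerSeries Fq) 0
    simp only [Nat.cast_zero] at this
    rw [sub_self, this, one_mul]; simpa using hcc

theorem aux_hensel_s13 (Fq : Type) [Field Fq] (h2 : (2:Fq) ≠ 0) (b0 b1 b2 : PowerSeries Fq)
    (hb0 : PowerSeries.constantCoeff b0 = 0) (hb1 : PowerSeries.constantCoeff b1 = -1)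
    (hb2 : PowerSeries.constantCoeff b2 = 0) (e : Fq) (he : e ^ 2 = 1) :
    ∃ u : PowerSeries Fq, PowerSeries.constantCoeff u = e ∧
      u ^ 3 + b2 * u ^ 2 + b1 * u + b0 = 0 := by
  have H : HenselianRing (PowerSeries Fq) (Ideal.span {PowerSeries.X}) := inferInstance
  let F : Polynomial (PowerSeries Fq) := Polynomial.X ^ 3 + Polynomial.C b2 * Polynomial.X ^ 2 +
    Polynomial.C b1 * Polynomial.X + Polynomial.C b0
  have hF : F.Monic := by simp only [F]; monicity!
  have hmem : ∀ x : PowerSeries Fq, x ∈ Ideal.span {(PowerSeries.X : PowerSeries Fq)} ↔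
      PowerSeries.constantCoeff x = 0 := by
    intro x; rw [Ideal.mem_span_singleton, PowerSeries.X_dvd_iff]
  obtain ⟨u, hu, hu2⟩ := H.is_henselian F hF (PowerSeries.C e) (by
      rw [hmem]
      simp [F, hb0, hb1, hb2]
      linear_combination e * he) (by
      apply IsUnit.map
      rw [PowerSeries.isUnit_iff_constantCoeff]
      apply IsUnit.mk0
      have : PowerSeries.constantCoeff (Polynomial.eval (PowerSeries.C e) F.derivative) = 2 := by
        simp [F, hb1, hb2]
        rw [map_ofNat]
        linear_combination 3 * he
      rw [this]; exact h2)
  rw [hmem] at hu2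
  refine ⟨u, ?_, ?_⟩
  · simpa [sub_eq_zero] using hu2
  · simpa [F, Polynomial.IsRoot] using hu

theorem aux_two (Fq : Type) [Field Fq] [Fintype Fq]
    (hq : ∀ r : ℕ, 1 ≤ r → Fintype.card Fq ≠ 2 ^ r) : (2:Fq) ≠ 0 := by
  intro h
  haveI : CharP Fq 2 := CharTwo.of_one_ne_zero_of_two_eq_zero one_ne_zero h
  obtain ⟨n, _, hn⟩ := FiniteField.card Fq 2
  exact hq n n.pos hn

theorem aux_root_s13 (Fq : Type) [Field Fq] (h2 : (2:Fq) ≠ 0) (l0 l1 l2 : Polynomial Fq) (s : ℕ)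
    (a : Fq) (ha : a ≠ 0) (hl1 : l1.natDegree = 2 * s) (hlc : l1.leadingCoeff = - a ^ 2)
    (hl2 : l2.natDegree < s) (hl0 : l0.natDegree < 3 * s) (e : Fq) (he : e ^ 2 = 1) :
    ∃ g : LaurentSeries Fq, g ≠ 0 ∧ g.order = -(s:ℤ) ∧ g.coeff (-(s:ℤ)) = a * e ∧
      g ^ 3 + polyEmb Fq l2 * g ^ 2 + polyEmb Fq l1 * g + polyEmb Fq l0 = 0 := by
  let r0 : PowerSeries Fq := ((Polynomial.reflect (3*s) l0 : Polynomial Fq) : PowerSeries Fq)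
  let r1 : PowerSeries Fq := ((Polynomial.reflect (2*s) l1 : Polynomial Fq) : PowerSeries Fq)
  let r2 : PowerSeries Fq := ((Polynomial.reflect s l2 : Polynomial Fq) : PowerSeries Fq)
  have c0 : PowerSeries.constantCoeff r0 = 0 := by
    simp [r0, Polynomial.coeff_reflect, Polynomial.coeff_eq_zero_of_natDegree_lt hl0]
  have c1 : PowerSeries.constantCoeff r1 = - a ^ 2 := by
    simp [r1, Polynomial.coeff_reflect, ← hlc, Polynomial.leadingCoeff, hl1]
  have c2 : PowerSeries.constantCoeff r2 = 0 := by
    simp [r2, Polynomial.coeff_reflect, Polynomial.coeff_eq_zero_of_natDegree_lt hl2]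
  obtain ⟨u, hu, hu2⟩ := aux_hensel_s13 Fq h2 (PowerSeries.C (a⁻¹ ^ 3) * r0)
    (PowerSeries.C (a⁻¹ ^ 2) * r1) (PowerSeries.C (a⁻¹) * r2) (by simp [c0])
    (by simp [c1, ha]) (by simp [c2]) e he
  have he0 : e ≠ 0 := by rintro rfl; simp at he
  obtain ⟨hn, ho⟩ := aux_order_s13 Fq u (by rw [hu]; exact he0)
  have hs : (HahnSeries.single (-(s:ℤ)) a) ≠ 0 := by simpa using ha
  refine ⟨HahnSeries.single (-(s:ℤ)) a * HahnSeries.ofPowerSeries ℤ Fq u, mul_ne_zero hs hn, ?_, ?_, ?_⟩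
  · rw [HahnSeries.order_mul hs hn, ho, HahnSeries.order_single ha]; simp
  · have := LaurentSeries.coeff_coe_powerSeries u 0
    simp only [Nat.cast_zero] at this
    rw [HahnSeries.coeff_single_mul, sub_self, this]; simp [hu]
  · rw [aux_polyEmb Fq s l2 hl2.le, aux_polyEmb Fq (2*s) l1 hl1.le, aux_polyEmb Fq (3*s) l0 hl0.le]
    change _ + _ * HahnSeries.ofPowerSeries ℤ Fq r2 * _ +
      _ * HahnSeries.ofPowerSeries ℤ Fq r1 * _ + _ * HahnSeries.ofPowerSeries ℤ Fq r0 = 0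
    have hX : ∀ n : ℕ, (HahnSeries.single (-((n * s : ℕ):ℤ)) (1:Fq)) =
        (HahnSeries.single (-(s:ℤ)) (1:Fq)) ^ n := by
      intro n; simp [HahnSeries.single_pow]
    have hS : HahnSeries.single (-(s:ℤ)) a = HahnSeries.C a * HahnSeries.single (-(s:ℤ)) (1:Fq) := by
      simp [HahnSeries.C_mul_eq_smul]
    have hC : (HahnSeries.C a * HahnSeries.C a⁻¹ : LaurentSeries Fq) = 1 := by
      rw [← map_mul, mul_inv_cancel₀ ha, map_one]
    rw [hX, hX, hS]
    have hE := congrArg (HahnSeries.ofPowerSeries ℤ Fq) hu2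
    simp only [map_add, map_mul, map_pow, map_zero, HahnSeries.ofPowerSeries_C] at hE
    generalize HahnSeries.ofPowerSeries ℤ Fq u = U at *
    generalize HahnSeries.ofPowerSeries ℤ Fq r0 = R0 at *
    generalize HahnSeries.ofPowerSeries ℤ Fq r1 = R1 at *
    generalize HahnSeries.ofPowerSeries ℤ Fq r2 = R2 at *
    generalize (HahnSeries.single (-(s:ℤ)) (1:Fq)) = T at *
    generalize (HahnSeries.C a : LaurentSeries Fq) = A at *
    generalize (HahnSeries.C a⁻¹ : LaurentSeries Fq) = B at *
    have hA : A ≠ 0 := left_ne_zero_of_mul_eq_one hC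
    have hB : B = A⁻¹ := eq_inv_of_mul_eq_one_right hC
    subst hB
    field_simp at hE
    linear_combination T ^ 3 * hE

theorem stmt_13 (Fq : Type) [Field Fq] [Fintype Fq]
    (C : Type) [Field C] [IsAlgClosed C]
    (φL : LaurentSeries Fq →+* C) (abv : AbsoluteValue C ℝ)
    (hna : ∀ x y : C, abv (x + y) ≤ max (abv x) (abv y))
    (hcomp : ∀ f : LaurentSeries Fq, f ≠ 0 → abv (φL f) = (Fintype.card Fq : ℝ) ^ (-f.order))
    (hq : ∀ r : ℕ, 1 ≤ r → Fintype.card Fq ≠ 2 ^ r)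
    (Λ : Polynomial (Polynomial Fq))
    (hmon : Λ.Monic) (hirr : Irreducible Λ) (hdeg : Λ.natDegree = 3) (h0 : Λ.coeff 0 ≠ 0)
    (hlt : pabs Fq (Λ.coeff 2) < pabs Fq (Λ.coeff 1))
    (hmax : ∀ i, i ≠ 1 → pabs Fq (Λ.coeff i) ≤ pabs Fq (Λ.coeff 1))
    (hatt : ∃ i, i ≠ 1 ∧ pabs Fq (Λ.coeff i) = pabs Fq (Λ.coeff 1))
    (hgt : 2 * (Λ.coeff 2).natDegree < (Λ.coeff 1).natDegree)
    (ω₁ ω₂ : C) (hne : ω₁ ≠ ω₂)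
    (hr1 : (Λ.map (φL.comp (polyEmb Fq))).eval ω₁ = 0)
    (hr2 : (Λ.map (φL.comp (polyEmb Fq))).eval ω₂ = 0)
    (h1 : 1 < abv ω₁) (h2 : 1 < abv ω₂)
    (honly : ∀ z ∈ (Λ.map (φL.comp (polyEmb Fq))).roots, 1 < abv z → z = ω₁ ∨ z = ω₂) :
    (ω₁ ∈ Set.range φL ∧ ω₂ ∈ Set.range φL ∧
     (∀ z ∈ (Λ.map (φL.comp (polyEmb Fq))).roots, z ≠ ω₁ → z ≠ ω₂ → abv z ≤ 1) ∧
     (∃ z ∈ (Λ.map (φL.comp (polyEmb Fq))).roots, abv z = 1))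
    ↔ (Even (Λ.coeff 1).natDegree ∧
       (∃ a : Fq, a ≠ 0 ∧ (Λ.coeff 1).leadingCoeff = -a ^ 2)) := by
  classical
  set l0 := Λ.coeff 0 with hl0
  set l1 := Λ.coeff 1 with hl1
  set l2 := Λ.coeff 2 with hl2
  set ψ := φL.comp (polyEmb Fq) with hψ
  have hq1 : (1:ℝ) < Fintype.card Fq := by exact_mod_cast Fintype.one_lt_card
  set q : ℝ := (Fintype.card Fq : ℝ) with hqdef
  have hq0 : 0 < q := by linarith
  have hl1ne : l1 ≠ 0 := by rintro h; rw [h] at hgt; simp at hgt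
  have hdpos : 0 < l1.natDegree := by omega
  have hpa : ∀ p : Polynomial Fq, p ≠ 0 → abv (ψ p) = q ^ (p.natDegree) := by
    intro p hp
    obtain ⟨e1, e2, -⟩ := aux_polyOrder Fq p hp
    rw [hψ, RingHom.comp_apply, hcomp _ e1, e2, neg_neg, zpow_natCast]
  have hdeg0 : l0.natDegree = l1.natDegree := by
    obtain ⟨i, hi, hia⟩ := hatt
    have hp1 : pabs Fq l1 = q ^ l1.natDegree := by simp [pabs, hl1ne, hqdef]
    have hp1pos : 1 < pabs Fq l1 := by
      rw [hp1]; exact one_lt_pow₀ hq1 (by omega)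
    have : i = 0 := by
      by_contra hi0
      by_cases i2 : i = 2
      · subst i2; exact absurd hia hlt.ne
      by_cases i3 : i = 3
      · subst i3
        have : Λ.coeff 3 = 1 := by rw [← hdeg]; exact hmon.coeff_natDegree
        rw [this] at hia
        rw [← hia] at hp1pos
        norm_num [pabs] at hp1pos
      · have : Λ.coeff i = 0 := Polynomial.coeff_eq_zero_of_natDegree_lt (by omega)
        rw [this] at hia
        rw [← hia] at hp1pos
        norm_num [pabs] at hp1pos
    subst this
    rw [hp1, ← hl0] at hia
    simp only [pabs, h0, if_false] at hia
    exact pow_right_injective₀ hq0 hq1.ne' hia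
  have hev : ∀ z : C, (Λ.map ψ).eval z = z ^ 3 + ψ l2 * z ^ 2 + ψ l1 * z + ψ l0 := by
    intro z
    rw [Polynomial.eval_map, Polynomial.eval₂_eq_sum_range, hdeg]
    have : Λ.coeff 3 = 1 := by rw [← hdeg]; exact hmon.coeff_natDegree
    simp only [Finset.sum_range_succ, Finset.sum_range_zero, this, ← hl0, ← hl1, ← hl2, map_one]
    ring
  have hmne : Λ.map ψ ≠ 0 := (hmon.map ψ).ne_zero
  have hroots : ∀ z : C, z ∈ (Λ.map ψ).roots ↔ z ^ 3 + ψ l2 * z ^ 2 + ψ l1 * z + ψ l0 = 0 := by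
    intro z
    rw [Polynomial.mem_roots hmne, Polynomial.IsRoot, hev]
  rw [hev] at hr1 hr2
  obtain ⟨ω₃, hω3⟩ : ∃ ω₃, ω₃ = -ψ l2 - ω₁ - ω₂ := ⟨_, rfl⟩
  have E1 : ψ l1 = ω₁ * ω₂ + ω₃ * (ω₁ + ω₂) := by
    apply mul_left_cancel₀ (sub_ne_zero.mpr hne)
    rw [hω3]
    linear_combination hr1 - hr2
  have E0 : ψ l0 = -(ω₁ * ω₂ * ω₃) := by
    rw [E1] at hr1
    rw [hω3] at hr1 ⊢
    linear_combination hr1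
  have hr3 : ω₃ ^ 3 + ψ l2 * ω₃ ^ 2 + ψ l1 * ω₃ + ψ l0 = 0 := by
    have : ψ l2 = -ω₃ - ω₁ - ω₂ := by rw [hω3]; ring
    rw [E1, E0, this]; ring
  have A1 : abv (ψ l1) = q ^ l1.natDegree := hpa l1 hl1ne
  have A0 : abv (ω₁ * ω₂ * ω₃) = q ^ l1.natDegree := by
    rw [← abv.map_neg, ← E0, hpa l0 h0, hdeg0]
  have A0' : abv ω₁ * abv ω₂ * abv ω₃ = q ^ l1.natDegree := by
    rw [← A0, abv.map_mul, abv.map_mul]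
  have hdp : (1:ℝ) < q ^ l1.natDegree := one_lt_pow₀ hq1 (by omega)
  have B3 : abv ω₃ ≤ 1 := by
    by_contra hc
    push Not at hc
    have i1 : abv (ω₁ * ω₂) < abv ω₁ * abv ω₂ * abv ω₃ := by
      rw [abv.map_mul]
      exact lt_mul_of_one_lt_right (by positivity) hc
    have i2 : abv (ω₃ * (ω₁ + ω₂)) < abv ω₁ * abv ω₂ * abv ω₃ := by
      rw [abv.map_mul, mul_comm]
      refine mul_lt_mul_of_pos_right ?_ (by linarith)
      refine lt_of_le_of_lt (hna _ _) (max_lt ?_ ?_)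
      · exact lt_mul_of_one_lt_right (by linarith) h2
      · exact lt_mul_of_one_lt_left (by linarith) h1
    have := lt_of_le_of_lt (hna (ω₁ * ω₂) (ω₃ * (ω₁ + ω₂))) (max_lt i1 i2)
    rw [← E1, A1, A0'] at this
    exact lt_irrefl _ this
  have i2 : abv (ω₃ * (ω₁ + ω₂)) < abv (ω₁ * ω₂) := by
    rw [abv.map_mul, abv.map_mul]
    refine lt_of_le_of_lt (mul_le_of_le_one_left (abv.nonneg _) B3) ?_
    refine lt_of_le_of_lt (hna _ _) (max_lt ?_ ?_)
    · exact lt_mul_of_one_lt_right (by linarith) h2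
    · exact lt_mul_of_one_lt_left (by linarith) h1
  have hNA : IsNonarchimedean abv := hna
  have A12 : abv ω₁ * abv ω₂ = q ^ l1.natDegree := by
    apply le_antisymm
    · by_contra hc
      push Not at hc
      have : ω₁ * ω₂ = ψ l1 + -(ω₃ * (ω₁ + ω₂)) := by rw [E1]; ring
      have h5 := hna (ψ l1) (-(ω₃ * (ω₁ + ω₂)))
      rw [← this, abv.map_neg, A1] at h5
      rw [← abv.map_mul] at hc
      exact absurd h5 (not_le.mpr (max_lt hc i2))
    · have := hna (ω₁ * ω₂) (ω₃ * (ω₁ + ω₂))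
      rw [← E1, A1, max_eq_left i2.le, abv.map_mul] at this
      exact this
  have C3 : abv ω₃ = 1 := by
    rw [A12] at A0'
    have : q ^ l1.natDegree ≠ 0 := by positivity
    exact mul_left_cancel₀ this (by rw [A0', mul_one])
  constructor
  · rintro ⟨⟨f₁, rfl⟩, ⟨f₂, rfl⟩, -, -⟩
    have n1 : f₁ ≠ 0 := by rintro rfl; simp at h1; linarith
    have n2 : f₂ ≠ 0 := by rintro rfl; simp at h2; linarith
    have o1 := hcomp f₁ n1
    have o2 := hcomp f₂ n2
    have oo : -(f₁.order) + -(f₂.order) = l1.natDegree := by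
      rw [o1, o2, ← zpow_add₀ hq0.ne', ← zpow_natCast] at A12
      exact zpow_right_injective₀ hq0 hq1.ne' A12
    have al2 : abv (ψ l2) ≤ q ^ l2.natDegree := by
      by_cases hz : l2 = 0
      · simp [hz]
      · exact (hpa l2 hz).le
    have sum12 : abv (φL f₁ + φL f₂) ≤ q ^ (l2.natDegree : ℤ) := by
      have e : φL f₁ + φL f₂ = -(ψ l2 + ω₃) := by rw [hω3]; ring
      rw [e, abv.map_neg, zpow_natCast]
      refine (hna _ _).trans (max_le al2 ?_)
      rw [C3]; exact one_le_pow₀ hq1.le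
    have oeq : f₁.order = f₂.order := by
      by_contra hno
      have hne' : abv (φL f₁) ≠ abv (φL f₂) := by
        rw [o1, o2]
        intro h
        have := zpow_right_injective₀ hq0 hq1.ne' h
        simp only [neg_inj] at this
        exact hno this
      have hm := hNA.add_eq_max_of_ne hne'
      rw [hm] at sum12
      have s1 := (le_max_left _ _).trans sum12
      have s2 := (le_max_right _ _).trans sum12
      rw [o1, zpow_le_zpow_iff_right₀ hq1] at s1
      rw [o2, zpow_le_zpow_iff_right₀ hq1] at s2
      omega
    refine ⟨⟨(-f₁.order).toNat, by omega⟩, f₁.leadingCoeff, HahnSeries.leadingCoeff_ne_zero.mpr n1, ?_⟩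
    have key : φL (polyEmb Fq l1 + f₁ * f₁) = (φL f₁ + ω₃) * (φL f₁ + φL f₂) := by
      rw [map_add, map_mul]
      change ψ l1 + _ = _
      rw [E1]; ring
    have kab : abv (φL (polyEmb Fq l1 + f₁ * f₁)) < q ^ (l1.natDegree : ℤ) := by
      rw [key, abv.map_mul]
      have t1 : abv (φL f₁ + ω₃) ≤ q ^ (-f₁.order) := by
        refine (hna _ _).trans (max_le o1.le ?_)
        rw [C3, ← o1]; exact h1.le
      refine lt_of_le_of_lt (mul_le_mul t1 sum12 (abv.nonneg _) (by positivity)) ?_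
      rw [← zpow_add₀ hq0.ne', zpow_lt_zpow_iff_right₀ hq1]
      omega
    have kc : (polyEmb Fq l1 + f₁ * f₁).coeff (-(l1.natDegree : ℤ)) = 0 := by
      by_cases hz : polyEmb Fq l1 + f₁ * f₁ = 0
      · rw [hz]; simp
      · rw [hcomp _ hz, zpow_lt_zpow_iff_right₀ hq1] at kab
        exact HahnSeries.coeff_eq_zero_of_lt_order (by omega)
    rw [HahnSeries.coeff_add, (aux_polyOrder Fq l1 hl1ne).2.2] at kc
    have hsq := HahnSeries.coeff_mul_order_add_order f₁ f₁
    rw [show f₁.order + f₁.order = -(l1.natDegree : ℤ) by omega] at hsq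
    rw [hsq] at kc
    linear_combination kc
  · rintro ⟨⟨s, hs⟩, a, ha, hlc⟩
    have t2 := aux_two Fq hq
    have main : ∀ e : Fq, e ^ 2 = 1 → ∃ g : LaurentSeries Fq, g.coeff (-(s:ℤ)) = a * e ∧
        (φL g = ω₁ ∨ φL g = ω₂) := by
      intro e he
      obtain ⟨g, g0, go, gc, gr⟩ := aux_root_s13 Fq t2 l0 l1 l2 s a ha (by omega) hlc (by omega)
        (by omega) e he
      refine ⟨g, gc, honly _ ?_ ?_⟩
      · rw [hroots]
        have := congrArg φL gr
        simpa [hψ] using this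
      · rw [hcomp g g0, go, neg_neg]
        exact one_lt_zpow₀ hq1 (by omega)
    obtain ⟨g1, c1, r1⟩ := main 1 (by ring)
    obtain ⟨g2, c2, r2⟩ := main (-1) (by ring)
    have hgne : φL g1 ≠ φL g2 := by
      intro h
      have := φL.injective h
      rw [this, c2] at c1
      have h7 : (2:Fq) * a = 0 := by linear_combination -c1
      exact (mul_ne_zero t2 ha) h7
    refine ⟨?_, ?_, ?_, ω₃, (hroots _).mpr hr3, C3⟩
    · rcases r1 with r1 | r1
      · exact ⟨g1, r1⟩
      · rcases r2 with r2 | r2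
        · exact ⟨g2, r2⟩
        · exact absurd (r1.trans r2.symm) hgne
    · rcases r1 with r1 | r1
      · rcases r2 with r2 | r2
        · exact absurd (r1.trans r2.symm) hgne
        · exact ⟨g2, r2⟩
      · exact ⟨g1, r1⟩
    · intro z hz z1 z2
      by_contra hc
      push Not at hc
      rcases honly z hz hc with h | h
      · exact z1 h
      · exact z2 h
end

section
/- (Main theorem, case (iii)) Let q not be a power of 2, n ≥ 3, and Λ(Y) = Yⁿ + λ_{n-1}Y^{n-1} + … + λ₀ ∈ F_q[X][Y] irreducible with λ₀ ≠ 0, satisfying deg λ_{n-1} < deg λ_{n-2} = max_{i ≠ n-2} deg λ_i. If deg λ_{n-2} < 2·deg λ_{n-1}, then the two roots ω₁, ω₂ of Λ of absolute value > 1 form a 2-Salem element lying in F_q((X^{-1})). -/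
open scoped Classical
set_option linter.unusedVariables false

open scoped Ring in
open Polynomial in
theorem hensel_aux (R : Type*) [CommRing R] (I : Ideal R) [IsAdicComplete I R]
    (f : Polynomial R) (a₀ : R) (h₁ : f.eval a₀ ∈ I)
    (h₂ : IsUnit (Ideal.Quotient.mk I (f.derivative.eval a₀))) :
    ∃ a : R, f.IsRoot a ∧ a - a₀ ∈ I := by
  classical
    let f' := derivative f
    let c : ℕ → R := fun n => Nat.recOn n a₀ fun _ b => b - f.eval b * (f'.eval b)⁻¹ʳ
    have hc : ∀ n, c (n + 1) = c n - f.eval (c n) * (f'.eval (c n))⁻¹ʳ := by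
      intro n
      simp only [c]
    have hc_mod : ∀ n, c n ≡ a₀ [SMOD I] := by
      intro n
      induction n with
      | zero => rfl
      | succ n ih => ?_
      rw [hc, sub_eq_add_neg, ← add_zero a₀]
      refine ih.add ?_
      rw [SModEq.zero, Ideal.neg_mem_iff]
      refine I.mul_mem_right _ ?_
      rw [← SModEq.zero] at h₁ ⊢
      exact (ih.eval f).trans h₁
    have hf'c : ∀ n, IsUnit (f'.eval (c n)) := by
      intro n
      have := isLocalHom_of_le_jacobson_bot I (IsAdicComplete.le_jacobson_bot I)
      apply IsUnit.of_map (Ideal.Quotient.mk I)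
      convert! h₂ using 1
      exact SModEq.def.mp ((hc_mod n).eval _)
    have hfcI : ∀ n, f.eval (c n) ∈ I ^ (n + 1) := by
      intro n
      induction n with
      | zero => simpa only [Nat.rec_zero, zero_add, pow_one] using! h₁
      | succ n ih => ?_
      rw [← taylor_eval_sub (c n), hc, sub_eq_add_neg, sub_eq_add_neg,
        add_neg_cancel_comm]
      rw [eval_eq_sum, sum_over_range' _ _ _ (lt_add_of_pos_right _ zero_lt_two), ←
        Finset.sum_range_add_sum_Ico _ (Nat.le_add_left _ _)]
      swap
      · intro i
        rw [zero_mul]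
      refine Ideal.add_mem _ ?_ ?_
      · rw [← one_add_one_eq_two, Finset.sum_range_succ, Finset.range_one, Finset.sum_singleton,
          taylor_coeff_zero, taylor_coeff_one, pow_zero, pow_one, mul_one, mul_neg,
          mul_left_comm, Ring.mul_inverse_cancel _ (hf'c n), mul_one, add_neg_cancel]
        exact Ideal.zero_mem _
      · refine Submodule.sum_mem _ ?_
        simp only [Finset.mem_Ico]
        rintro i ⟨h2i, _⟩
        have aux : n + 2 ≤ i * (n + 1) := by trans 2 * (n + 1) <;> nlinarith only [h2i]
        refine Ideal.mul_mem_left _ _ (Ideal.pow_le_pow_right aux ?_)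
        rw [pow_mul']
        exact Ideal.pow_mem_pow ((Ideal.neg_mem_iff _).2 <| Ideal.mul_mem_right _ _ ih) _
    have aux : ∀ m n, m ≤ n → c m ≡ c n [SMOD (I ^ m • ⊤ : Ideal R)] := by
      intro m n hmn
      rw [← Ideal.one_eq_top, Ideal.smul_eq_mul, mul_one]
      obtain ⟨k, rfl⟩ := Nat.exists_eq_add_of_le hmn
      clear hmn
      induction k with
      | zero => rw [add_zero]
      | succ k ih => ?_
      rw [← add_assoc, hc, ← add_zero (c m), sub_eq_add_neg]
      refine ih.add ?_
      symm
      rw [SModEq.zero, Ideal.neg_mem_iff]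
      refine Ideal.mul_mem_right _ _ (Ideal.pow_le_pow_right ?_ (hfcI _))
      rw [add_assoc]
      exact le_self_add
    obtain ⟨a, ha⟩ := IsPrecomplete.prec' c (aux _ _)
    refine ⟨a, ?_, ?_⟩
    · show f.IsRoot a
      suffices ∀ n, f.eval a ≡ 0 [SMOD (I ^ n • ⊤ : Ideal R)] by exact IsHausdorff.haus' _ this
      intro n
      specialize ha n
      rw [← Ideal.one_eq_top, Ideal.smul_eq_mul, mul_one] at ha ⊢
      refine (ha.symm.eval f).trans ?_
      rw [SModEq.zero]
      exact Ideal.pow_le_pow_right le_self_add (hfcI _)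
    · show a - a₀ ∈ I
      specialize ha (0 + 1)
      rw [hc, pow_one, ← Ideal.one_eq_top, Ideal.smul_eq_mul, mul_one, sub_eq_add_neg] at ha
      rw [← SModEq.sub_mem, ← add_zero a₀]
      refine ha.symm.trans (SModEq.rfl.add ?_)
      rw [SModEq.zero, Ideal.neg_mem_iff]
      exact Ideal.mul_mem_right _ _ h₁

open Polynomial in
theorem dom_aux (C : Type) [Field C] (abv : AbsoluteValue C ℝ)
    (hna : ∀ x y : C, abv (x + y) ≤ max (abv x) (abv y)) (s : Multiset C)
    (hs : ∀ r ∈ s, abv r ≠ 1) :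
    ∃ k, ∀ i, i ≠ k → abv ((s.map (fun r => X - Polynomial.C r)).prod.coeff i) <
      abv ((s.map (fun r => X - Polynomial.C r)).prod.coeff k) := by
  have hsub : ∀ x y : C, abv (x - y) ≤ max (abv x) (abv y) := fun x y => by
    rw [sub_eq_add_neg, ← abv.map_neg y]; exact hna _ _
  have hlt : ∀ x y : C, abv y < abv x → abv (x - y) = abv x := fun x y h => by
    apply le_antisymm
    · exact (hsub x y).trans (by simp [h.le])
    · by_contra! h'
      have := hna (x - y) y
      rw [sub_add_cancel] at this
      exact absurd this (not_le.mpr (max_lt h' h))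
  have hlt' : ∀ x y : C, abv x < abv y → abv (x - y) = abv y := fun x y h => by
    rw [← abv.map_neg, neg_sub]; exact hlt _ _ h
  induction s using Multiset.induction_on with
  | empty =>
    refine ⟨0, fun i hi => ?_⟩
    simp [Polynomial.coeff_one, hi]
  | cons r s ih =>
    obtain ⟨k, hk⟩ := ih (fun r' hr' => hs r' (Multiset.mem_cons_of_mem hr'))
    have hr := hs r (Multiset.mem_cons_self r s)
    rw [Multiset.map_cons, Multiset.prod_cons]
    set p := (s.map (fun r => X - Polynomial.C r)).prod with hp
    have hpos : 0 < abv (p.coeff k) := (abv.nonneg _).trans_lt (hk (k + 1) (by omega))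
    have hle : ∀ i, abv (p.coeff i) ≤ abv (p.coeff k) := fun i => by
      by_cases h : i = k
      · rw [h]
      · exact (hk i h).le
    have hc0 : ((X - Polynomial.C r) * p).coeff 0 = 0 - r * p.coeff 0 := by
      simp [sub_mul]
    have hc : ∀ i, ((X - Polynomial.C r) * p).coeff (i + 1) = p.coeff i - r * p.coeff (i + 1) := by
      intro i
      simp [sub_mul, Polynomial.coeff_C_mul, Polynomial.coeff_X_mul]
    have hrp : ∀ i, abv (r * p.coeff i) = abv r * abv (p.coeff i) := fun i => abv.map_mul _ _
    have hr0 := abv.nonneg r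
    rcases lt_or_gt_of_ne hr with h | h
    · have hsm : ∀ i, abv (r * p.coeff i) < abv (p.coeff k) := fun i => by
        rw [hrp]; nlinarith [hle i, abv.nonneg (p.coeff i)]
      refine ⟨k + 1, fun i hi => ?_⟩
      rw [hc k, hlt _ _ (hsm _)]
      cases i with
      | zero =>
        rw [hc0]; exact (hsub _ _).trans_lt (max_lt (by simpa using hpos) (hsm _))
      | succ i =>
        rw [hc]
        exact (hsub _ _).trans_lt (max_lt (hk i (by omega)) (hsm _))
    · have hbig : ∀ i, abv (p.coeff i) < abv (r * p.coeff k) := fun i => by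
        rw [hrp]; nlinarith [hle i]
      have hkk : abv (((X - Polynomial.C r) * p).coeff k) = abv (r * p.coeff k) := by
        cases k with
        | zero => rw [hc0, zero_sub, abv.map_neg]
        | succ k => rw [hc, hlt' _ _ (hbig _)]
      refine ⟨k, fun i hi => ?_⟩
      rw [hkk]
      have h3 : abv (r * p.coeff i) < abv (r * p.coeff k) := by
        rw [hrp, hrp]
        exact mul_lt_mul_of_pos_left (hk i hi) (by linarith)
      cases i with
      | zero =>
        rw [hc0, zero_sub, abv.map_neg]; exact h3
      | succ i =>
        rw [hc]
        exact (hsub _ _).trans_lt (max_lt (hbig _) h3)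

theorem polyEmb_coeff_aux (Fq : Type) [Field Fq] (p : Polynomial Fq) (j : ℤ) :
    (polyEmb Fq p).coeff j = if j ≤ 0 then p.coeff (-j).toNat else 0 := by
  induction p using Polynomial.induction_on' with
  | add p q hp hq =>
    rw [map_add, HahnSeries.coeff_add, hp, hq]
    split_ifs <;> simp
  | monomial n a =>
    have : polyEmb Fq (Polynomial.monomial n a) = HahnSeries.single (-(n : ℤ)) a := by
      simp [polyEmb, HahnSeries.single_pow, HahnSeries.C_apply]
    rw [this, HahnSeries.coeff_single, Polynomial.coeff_monomial]
    split_ifs <;> first | rfl | omega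

theorem polyEmb_order_aux (Fq : Type) [Field Fq] (p : Polynomial Fq) (hp : p ≠ 0) :
    polyEmb Fq p ≠ 0 ∧ (polyEmb Fq p).order = -(p.natDegree : ℤ) := by
  have h1 : (polyEmb Fq p).coeff (-(p.natDegree : ℤ)) ≠ 0 := by
    rw [polyEmb_coeff_aux]
    simpa using hp
  have h0 : polyEmb Fq p ≠ 0 := by
    intro h; rw [h] at h1; simp at h1
  refine ⟨h0, le_antisymm (HahnSeries.order_le_of_coeff_ne_zero h1) ?_⟩
  rw [HahnSeries.le_order_iff_forall h0]
  intro j hj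
  rw [polyEmb_coeff_aux, if_pos (by omega)]
  exact Polynomial.coeff_eq_zero_of_natDegree_lt (by omega)

theorem small_aux (Fq : Type) [Field Fq] (f : LaurentSeries Fq) (hf : f ≠ 0 → 0 < f.order) :
    ∃ p : PowerSeries Fq, HahnSeries.ofPowerSeries ℤ Fq p = f ∧
      PowerSeries.constantCoeff p = 0 := by
  by_cases h : f = 0
  · exact ⟨0, by simp [h], by simp⟩
  · have ho := hf h
    obtain ⟨n, hn⟩ : ∃ n : ℕ, ((n + 1 : ℕ) : ℤ) = f.order := ⟨(f.order - 1).toNat, by omega⟩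
    refine ⟨_, LaurentSeries.X_order_mul_powerSeriesPart hn, ?_⟩
    simp

theorem root_aux (Fq : Type) [Field Fq] (P : Polynomial (LaurentSeries Fq)) (m : ℕ)
    (h1 : P.coeff (m + 1) = 1) (h2 : P.coeff m = 1)
    (h3 : ∀ i, i ≠ m → i ≠ m + 1 → P.coeff i ≠ 0 → 0 < (P.coeff i).order) :
    ∃ θ : LaurentSeries Fq, θ ≠ 0 ∧ θ.order = 0 ∧ P.eval θ = 0 := by
  have hinj : Function.Injective (HahnSeries.ofPowerSeries ℤ Fq) :=
    HahnSeries.ofPowerSeries_injective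
  have hl : P ∈ Polynomial.lifts (HahnSeries.ofPowerSeries ℤ Fq) := by
    rw [Polynomial.lifts_iff_coeff_lifts]
    intro i
    by_cases hi : i = m
    · exact ⟨1, by rw [hi, h2, map_one]⟩
    by_cases hi' : i = m + 1
    · exact ⟨1, by rw [hi', h1, map_one]⟩
    obtain ⟨p, hp, _⟩ := small_aux Fq (P.coeff i) (h3 i hi hi')
    exact ⟨p, hp⟩
  obtain ⟨Q, hQ⟩ := (Polynomial.mem_lifts _).1 hl
  have hcoe : ∀ i, HahnSeries.ofPowerSeries ℤ Fq (Q.coeff i) = P.coeff i := fun i => by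
    rw [← hQ, Polynomial.coeff_map]
  have hred : Q.map (PowerSeries.constantCoeff (R := Fq)) =
      Polynomial.X ^ m * (Polynomial.X + 1) := by
    ext i
    rw [Polynomial.coeff_map, mul_add, mul_one, ← pow_succ, Polynomial.coeff_add,
      Polynomial.coeff_X_pow, Polynomial.coeff_X_pow]
    by_cases hi : i = m
    · have : Q.coeff i = 1 := hinj (by rw [hcoe, hi, h2, map_one])
      rw [this]; simp [hi]
    by_cases hi' : i = m + 1
    · have : Q.coeff i = 1 := hinj (by rw [hcoe, hi', h1, map_one])
      rw [this]; simp [hi']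
    obtain ⟨p, hp, hp0⟩ := small_aux Fq (P.coeff i) (h3 i hi hi')
    have : Q.coeff i = p := hinj (by rw [hcoe, hp])
    rw [this]; simp [hi, hi', hp0]
  have hev : ∀ (R : Polynomial (PowerSeries Fq)) (a : PowerSeries Fq),
      PowerSeries.constantCoeff (R.eval a) =
      (R.map PowerSeries.constantCoeff).eval (PowerSeries.constantCoeff a) := fun R a => by
    rw [Polynomial.eval_map, Polynomial.eval₂_hom]
  obtain ⟨θ, hθ, hθ1⟩ := hensel_aux (PowerSeries Fq) (Ideal.span {PowerSeries.X}) Q (-1)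
    (by
      rw [Ideal.mem_span_singleton, PowerSeries.X_dvd_iff, hev, hred]
      simp)
    (by
      apply IsUnit.map
      rw [PowerSeries.isUnit_iff_constantCoeff, hev, ← Polynomial.derivative_map, hred]
      simp [Polynomial.derivative_mul])
  rw [Ideal.mem_span_singleton, PowerSeries.X_dvd_iff, map_sub, sub_eq_zero] at hθ1
  have hc0 : (HahnSeries.ofPowerSeries ℤ Fq θ).coeff 0 ≠ 0 := by
    have := LaurentSeries.coeff_coe_powerSeries θ 0
    simp only [Nat.cast_zero] at this
    rw [this, PowerSeries.coeff_zero_eq_constantCoeff_apply, hθ1]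
    simp
  have h0 : HahnSeries.ofPowerSeries ℤ Fq θ ≠ 0 := fun h => by rw [h] at hc0; simp at hc0
  refine ⟨HahnSeries.ofPowerSeries ℤ Fq θ, h0, le_antisymm
    (HahnSeries.order_le_of_coeff_ne_zero hc0) ?_, ?_⟩
  · rw [HahnSeries.le_order_iff_forall h0]
    intro j hj
    rw [PowerSeries.coeff_coe, if_pos hj]
  · rw [← hQ, Polynomial.eval_map, Polynomial.eval₂_hom, hθ.eq_zero, map_zero]

theorem root_scaled_aux (Fq : Type) [Field Fq] [Fintype Fq]
    (ν : AbsoluteValue (LaurentSeries Fq) ℝ)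
    (hν : ∀ f : LaurentSeries Fq, f ≠ 0 → ν f = (Fintype.card Fq : ℝ) ^ (-f.order))
    (P : Polynomial (LaurentSeries Fq)) (m : ℕ) (k c : LaurentSeries Fq) (hk : k ≠ 0)
    (h1 : k * (P.coeff (m + 1) * c ^ (m + 1)) = 1) (h2 : k * (P.coeff m * c ^ m) = 1)
    (h3 : ∀ i, i ≠ m → i ≠ m + 1 → ν (k * (P.coeff i * c ^ i)) < 1) :
    ∃ θ : LaurentSeries Fq, ν θ = ν c ∧ P.eval θ = 0 := by
  have hq : (1 : ℝ) < Fintype.card Fq := by exact_mod_cast Fintype.one_lt_card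
  have hcf : ∀ i, (Polynomial.C k * P.comp (Polynomial.C c * Polynomial.X)).coeff i =
      k * (P.coeff i * c ^ i) := fun i => by
    rw [Polynomial.coeff_C_mul, Polynomial.comp_C_mul_X_coeff]
  obtain ⟨θ, hθ0, hθo, hθ⟩ := root_aux Fq (Polynomial.C k * P.comp (Polynomial.C c * Polynomial.X)) m
    (by rw [hcf, h1]) (by rw [hcf, h2]) (fun i hi hi' h => by
      rw [hcf] at h ⊢
      have := h3 i hi hi'
      rw [hν _ h] at this
      by_contra! hle
      exact absurd this (not_lt.mpr (one_le_zpow₀ hq.le (by omega))))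
  refine ⟨c * θ, ?_, ?_⟩
  · rw [map_mul, hν θ hθ0, hθo]; simp
  · simpa [hk] using hθ

theorem stmt_14 (Fq : Type) [Field Fq] [Fintype Fq]
    (C : Type) [Field C] [IsAlgClosed C]
    (φL : LaurentSeries Fq →+* C) (abv : AbsoluteValue C ℝ)
    (hna : ∀ x y : C, abv (x + y) ≤ max (abv x) (abv y))
    (hcomp : ∀ f : LaurentSeries Fq, f ≠ 0 → abv (φL f) = (Fintype.card Fq : ℝ) ^ (-f.order))
    (hq : ∀ r : ℕ, 1 ≤ r → Fintype.card Fq ≠ 2 ^ r)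
    (n : ℕ) (hn : 3 ≤ n) (Λ : Polynomial (Polynomial Fq))
    (hmon : Λ.Monic) (hirr : Irreducible Λ) (hdeg : Λ.natDegree = n) (h0 : Λ.coeff 0 ≠ 0)
    (hlt : pabs Fq (Λ.coeff (n - 1)) < pabs Fq (Λ.coeff (n - 2)))
    (hmax : ∀ i, i ≠ n - 2 → pabs Fq (Λ.coeff i) ≤ pabs Fq (Λ.coeff (n - 2)))
    (hatt : ∃ i, i ≠ n - 2 ∧ pabs Fq (Λ.coeff i) = pabs Fq (Λ.coeff (n - 2)))
    (hlt2 : (Λ.coeff (n - 2)).natDegree < 2 * (Λ.coeff (n - 1)).natDegree)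
    (ω₁ ω₂ : C) (hne : ω₁ ≠ ω₂)
    (hr1 : (Λ.map (φL.comp (polyEmb Fq))).eval ω₁ = 0)
    (hr2 : (Λ.map (φL.comp (polyEmb Fq))).eval ω₂ = 0)
    (h1 : 1 < abv ω₁) (h2 : 1 < abv ω₂)
    (honly : ∀ z ∈ (Λ.map (φL.comp (polyEmb Fq))).roots, 1 < abv z → z = ω₁ ∨ z = ω₂) :
    ω₁ ∈ Set.range φL ∧ ω₂ ∈ Set.range φL ∧
    (∀ z ∈ (Λ.map (φL.comp (polyEmb Fq))).roots, z ≠ ω₁ → z ≠ ω₂ → abv z ≤ 1) ∧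
    (∃ z ∈ (Λ.map (φL.comp (polyEmb Fq))).roots, abv z = 1) := by
  have hq1 : (1 : ℝ) < Fintype.card Fq := by exact_mod_cast Fintype.one_lt_card
  have hpe : ∀ p : Polynomial Fq, abv (φL (polyEmb Fq p)) = pabs Fq p := fun p => by
    unfold pabs
    split_ifs with h
    · simp [h]
    · obtain ⟨h0, ho⟩ := polyEmb_order_aux Fq p h
      rw [hcomp _ h0, ho, neg_neg, zpow_natCast]
  obtain ⟨k, rfl⟩ : ∃ k, n = k + 3 := ⟨n - 3, by omega⟩
  simp only [show k + 3 - 1 = k + 2 by omega, show k + 3 - 2 = k + 1 by omega] at *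
  have hlead : Λ.coeff (k + 3) = 1 := by rw [← hdeg]; exact hmon
  have hhigh : ∀ i, k + 3 < i → Λ.coeff i = 0 := fun i hi =>
    Polynomial.coeff_eq_zero_of_natDegree_lt (by omega)
  have hA0 : Λ.coeff (k + 2) ≠ 0 := by
    intro h; rw [h] at hlt2; simp at hlt2
  have hB0 : Λ.coeff (k + 1) ≠ 0 := by
    intro h
    rw [h] at hlt
    have : (0:ℝ) ≤ pabs Fq (Λ.coeff (k + 2)) := by rw [← hpe]; exact abv.nonneg _
    simp only [pabs, if_true] at hlt this
    linarith
  have hA1 : 1 < pabs Fq (Λ.coeff (k + 2)) := by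
    rw [pabs, if_neg hA0]
    exact one_lt_pow₀ hq1 (by omega)
  have hBA : pabs Fq (Λ.coeff (k + 1)) < pabs Fq (Λ.coeff (k + 2)) ^ 2 := by
    rw [pabs, pabs, if_neg hA0, if_neg hB0, ← pow_mul]
    exact pow_lt_pow_right₀ hq1 (by omega)
  have hmap0 : Λ.map (φL.comp (polyEmb Fq)) ≠ 0 := (hmon.map _).ne_zero
  let ν : AbsoluteValue (LaurentSeries Fq) ℝ := abv.comp φL.injective
  have hνd : ∀ f, ν f = abv (φL f) := fun f => rfl
  have hνp : ∀ p, ν (polyEmb Fq p) = pabs Fq p := hpe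
  have hν : ∀ f : LaurentSeries Fq, f ≠ 0 → ν f = (Fintype.card Fq : ℝ) ^ (-f.order) := hcomp
  set a : LaurentSeries Fq := polyEmb Fq (Λ.coeff (k + 2)) with ha
  set b : LaurentSeries Fq := polyEmb Fq (Λ.coeff (k + 1)) with hb
  have ha0 : a ≠ 0 := (polyEmb_order_aux Fq _ hA0).1
  have hb0 : b ≠ 0 := (polyEmb_order_aux Fq _ hB0).1
  have hνa : ν a = pabs Fq (Λ.coeff (k + 2)) := hνp _
  have hνb : ν b = pabs Fq (Λ.coeff (k + 1)) := hνp _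
  rw [← hνa] at hA1 hBA hlt
  rw [← hνb] at hBA hlt
  set PL := Λ.map (polyEmb Fq) with hPL
  have hPc : ∀ i, PL.coeff i = polyEmb Fq (Λ.coeff i) := fun i => Polynomial.coeff_map _ _
  have hPle : ∀ i, ν (PL.coeff i) ≤ ν b := fun i => by
    rw [hPc, hνp, hνb]
    by_cases h : i = k + 1
    · rw [h]
    · exact hmax i h
  have hPhigh : ∀ i, k + 3 < i → PL.coeff i = 0 := fun i hi => by rw [hPc, hhigh i hi, map_zero]
  have hP3 : PL.coeff (k + 3) = 1 := by rw [hPc, hlead, map_one]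
  have hP2 : PL.coeff (k + 2) = a := hPc _
  have hP1 : PL.coeff (k + 1) = b := hPc _
  obtain ⟨θ₁, hθ₁, hθ₁r⟩ := root_scaled_aux Fq ν hν PL (k + 2) (a ^ (k + 3))⁻¹ a
    (inv_ne_zero (pow_ne_zero _ ha0))
    (by rw [hP3]; field_simp)
    (by rw [hP2]; field_simp; ring)
    (fun i hi hi' => by
      by_cases h : k + 3 < i
      · rw [hPhigh i h]; simp
      · have hpos : 0 < ν a := by linarith
        rw [map_mul, map_mul, map_inv₀, map_pow, map_pow, inv_mul_lt_iff₀ (by positivity), mul_one]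
        calc ν (PL.coeff i) * ν a ^ i ≤ ν b * ν a ^ (k + 1) := by
              gcongr
              · exact hPle i
              · exact hA1.le
              · omega
          _ < ν a ^ 2 * ν a ^ (k + 1) := by gcongr
          _ = ν a ^ (k + 3) := by ring)
  have hpa : 0 < ν a := by linarith
  have hpb : 0 < ν b := by linarith
  have hνc : ν (b / a) = ν b / ν a := map_div₀ _ _ _
  have hc1 : 1 < ν (b / a) := by rw [hνc, one_lt_div hpa]; exact hlt
  have hc2 : ν (b / a) < ν a := by rw [hνc, div_lt_iff₀ hpa]; nlinarith
  have hba0 : b / a ≠ 0 := div_ne_zero hb0 ha0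
  obtain ⟨θ₂, hθ₂, hθ₂r⟩ := root_scaled_aux Fq ν hν PL (k + 1) (b * (b / a) ^ (k + 1))⁻¹ (b / a)
    (inv_ne_zero (mul_ne_zero hb0 (pow_ne_zero _ hba0)))
    (by
      rw [show k + 1 + 1 = k + 2 by omega, hP2, pow_succ (b / a) (k + 1)]
      rw [show a * ((b / a) ^ (k + 1) * (b / a)) = b * (b / a) ^ (k + 1) by field_simp]
      exact inv_mul_cancel₀ (mul_ne_zero hb0 (pow_ne_zero _ hba0)))
    (by
      rw [hP1]
      exact inv_mul_cancel₀ (mul_ne_zero hb0 (pow_ne_zero _ hba0)))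
    (fun i hi hi' => by
      have hpc : 0 < ν (b / a) := by linarith
      by_cases h : k + 3 < i
      · rw [hPhigh i h]; simp
      · rw [map_mul, map_mul, map_inv₀, map_mul, map_pow, map_pow,
          inv_mul_lt_iff₀ (by positivity), mul_one]
        by_cases h' : i = k + 3
        · rw [h', hP3, map_one, one_mul, show k + 3 = 2 + (k + 1) by omega, pow_add]
          gcongr
          rw [hνc, div_pow, div_lt_iff₀ (by positivity)]
          nlinarith
        · calc ν (PL.coeff i) * ν (b / a) ^ i ≤ ν b * ν (b / a) ^ i := by
                gcongr
                exact hPle i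
            _ < ν b * ν (b / a) ^ (k + 1) := by
                gcongr
                omega)
  have hroot : ∀ θ, PL.eval θ = 0 → φL θ ∈ (Λ.map (φL.comp (polyEmb Fq))).roots := fun θ hθ => by
    rw [Polynomial.mem_roots hmap0, Polynomial.IsRoot, ← Polynomial.map_map, ← hPL,
      Polynomial.eval_map, Polynomial.eval₂_hom, hθ, map_zero]
  have hm1 := honly _ (hroot _ hθ₁r) (by rw [← hνd, hθ₁]; exact hA1)
  have hm2 := honly _ (hroot _ hθ₂r) (by rw [← hνd, hθ₂]; exact hc1)
  have hd : φL θ₁ ≠ φL θ₂ := fun h => by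
    have : ν θ₁ = ν θ₂ := by rw [hνd, hνd, h]
    rw [hθ₁, hθ₂] at this
    linarith
  have hmem : ω₁ ∈ Set.range φL ∧ ω₂ ∈ Set.range φL := by
    rcases hm1 with h | h <;> rcases hm2 with h' | h'
    · exact absurd (h.trans h'.symm) hd
    · exact ⟨⟨_, h⟩, ⟨_, h'⟩⟩
    · exact ⟨⟨_, h'⟩, ⟨_, h⟩⟩
    · exact absurd (h.trans h'.symm) hd
  refine ⟨hmem.1, hmem.2, ?_, ?_⟩
  · intro z hz hz1 hz2
    by_contra! h
    rcases honly z hz h with h | h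
    · exact hz1 h
    · exact hz2 h
  · by_contra! hno
    obtain ⟨K, hK⟩ := dom_aux C abv hna _ hno
    have hprod : ((Λ.map (φL.comp (polyEmb Fq))).roots.map
        (fun r => Polynomial.X - Polynomial.C r)).prod = Λ.map (φL.comp (polyEmb Fq)) :=
      ((IsAlgClosed.splits _).eq_prod_roots_of_monic (hmon.map _)).symm
    rw [hprod] at hK
    have hcc : ∀ i, abv ((Λ.map (φL.comp (polyEmb Fq))).coeff i) = pabs Fq (Λ.coeff i) := fun i => by
      rw [Polynomial.coeff_map, RingHom.comp_apply, hpe]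
    simp only [hcc] at hK
    obtain ⟨i, hi, hie⟩ := hatt
    by_cases h : K = k + 1
    · subst h
      exact absurd hie (hK i hi).ne
    · have h4 := hK (k + 1) (Ne.symm h)
      exact absurd h4 (not_lt.mpr (hmax K h))
end
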